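/- arXiv:math-ph/0309062 — 5 statements merged into one kernel-verified Lean document; each statement's English description precedes it below -/
import Mathlib

section
/- Let ε, μ > 0 and β ∈ ℝ. Let E, H, j : ℝ × ℝ³ → ℝ³ be smooth vector fields and ρ : ℝ × ℝ³ → ℝ smooth, satisfying the continuity equation ∂ₜρ + div j = 0. Define the purely vectorial biquaternion-valued function V(t,x) = E(t,x) − i√(μ/ε) H(t,x). Then E and H solve the chiral Maxwell system (rot H = ε(∂ₜE + β ∂ₜ rot E) + j; rot E = −μ(∂ₜH + β ∂ₜ rot H); div E = ρ/ε; div H = 0) if and only if V solves the quaternionic equation M V = −√(μ/ε) j − β√(μ/ε) ∂ₜρ + i ρ/ε. -/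
noncomputable section

/-- Points of `ℝ³`. -/
abbrev V3 : Type := Fin 3 → ℝ

/-- Biquaternions `ℍ[ℂ]`: quaternions with complex coefficients. -/
abbrev BQ : Type := Quaternion ℂ

/-- Euclidean norm on `ℝ³`. -/
def enorm3 (x : V3) : ℝ := Real.sqrt (x 0 ^ 2 + x 1 ^ 2 + x 2 ^ 2)

/-- Spatial partial derivative of a real-valued function. -/
def pdR (k : Fin 3) (g : V3 → ℝ) (x : V3) : ℝ := fderiv ℝ g x (Pi.single k 1)

/-- Spatial partial derivative of a complex-valued function. -/
def pdC (k : Fin 3) (g : V3 → ℂ) (x : V3) : ℂ := fderiv ℝ g x (Pi.single k 1)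

/-- Divergence (in the space variables) of a time-dependent vector field. -/
def div3 (E : ℝ × V3 → V3) (p : ℝ × V3) : ℝ :=
  ∑ k : Fin 3, pdR k (fun y => E (p.1, y) k) p.2

/-- Curl (in the space variables) of a time-dependent vector field. -/
def rot3 (E : ℝ × V3 → V3) (p : ℝ × V3) : V3 :=
  ![pdR 1 (fun y => E (p.1, y) 2) p.2 - pdR 2 (fun y => E (p.1, y) 1) p.2,
    pdR 2 (fun y => E (p.1, y) 0) p.2 - pdR 0 (fun y => E (p.1, y) 2) p.2,
    pdR 0 (fun y => E (p.1, y) 1) p.2 - pdR 1 (fun y => E (p.1, y) 0) p.2]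

/-- Time derivative of a vector field. -/
def ptV (E : ℝ × V3 → V3) (p : ℝ × V3) : V3 := deriv (fun s => E (s, p.2)) p.1

/-- Time derivative of a scalar (real-valued) function. -/
def ptR (ρ : ℝ × V3 → ℝ) (p : ℝ × V3) : ℝ := deriv (fun s => ρ (s, p.2)) p.1

/-- Build a biquaternion from a complex scalar part and a complex vector part. -/
def bq (s : ℂ) (v : Fin 3 → ℂ) : BQ := ⟨s, v 0, v 1, v 2⟩

/-- A complex vector as a purely vectorial biquaternion. -/
def vecC (v : Fin 3 → ℂ) : BQ := bq 0 v

/-- A real vector as a purely vectorial biquaternion. -/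
def vecR (v : V3) : BQ := vecC (fun k => (v k : ℂ))

/-- The basic quaternionic imaginary units `i₁, i₂, i₃`. -/
def qi : Fin 3 → BQ := ![⟨0,1,0,0⟩, ⟨0,0,1,0⟩, ⟨0,0,0,1⟩]

/-- Componentwise spatial partial derivative of a biquaternion-valued function. -/
def pdQ (k : Fin 3) (F : V3 → BQ) (x : V3) : BQ :=
  ⟨pdC k (fun y => (F y).re) x, pdC k (fun y => (F y).imI) x,
   pdC k (fun y => (F y).imJ) x, pdC k (fun y => (F y).imK) x⟩

/-- The Moisil–Teodoresco operator `D F = i₁ ∂₁F + i₂ ∂₂F + i₃ ∂₃F`. -/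
def Dop (F : V3 → BQ) (x : V3) : BQ :=
  qi 0 * pdQ 0 F x + qi 1 * pdQ 1 F x + qi 2 * pdQ 2 F x

/-- The Moisil–Teodoresco operator acting in the space variables. -/
def DQ (F : ℝ × V3 → BQ) (p : ℝ × V3) : BQ := Dop (fun y => F (p.1, y)) p.2

/-- Componentwise time derivative of a biquaternion-valued function. -/
def ptQ (F : ℝ × V3 → BQ) (p : ℝ × V3) : BQ :=
  ⟨deriv (fun s => (F (s, p.2)).re) p.1, deriv (fun s => (F (s, p.2)).imI) p.1,
   deriv (fun s => (F (s, p.2)).imJ) p.1, deriv (fun s => (F (s, p.2)).imK) p.1⟩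

/-- The operator `M = β√(εμ) ∂ₜ D + √(εμ) ∂ₜ − iD`. -/
def Mop (ε μ β : ℝ) (F : ℝ × V3 → BQ) (p : ℝ × V3) : BQ :=
  ((β * Real.sqrt (ε * μ) : ℝ) : ℂ) • ptQ (DQ F) p
    + ((Real.sqrt (ε * μ) : ℝ) : ℂ) • ptQ F p
    - Complex.I • DQ F p

/-- The complex conjugate operator `M* = β√(εμ) ∂ₜ D + √(εμ) ∂ₜ + iD`. -/
def MstarOp (ε μ β : ℝ) (F : ℝ × V3 → BQ) (p : ℝ × V3) : BQ :=
  ((β * Real.sqrt (ε * μ) : ℝ) : ℂ) • ptQ (DQ F) p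
    + ((Real.sqrt (ε * μ) : ℝ) : ℂ) • ptQ F p
    + Complex.I • DQ F p

/-- `C^n` smoothness of a biquaternion-valued function, componentwise. -/
def ContDiffQ (n : ℕ∞) (F : ℝ × V3 → BQ) : Prop :=
  ContDiff ℝ n (fun p => (F p).re) ∧ ContDiff ℝ n (fun p => (F p).imI) ∧
  ContDiff ℝ n (fun p => (F p).imJ) ∧ ContDiff ℝ n (fun p => (F p).imK)

/-- `Θ_α(x) = −e^{iα|x|}/(4π|x|)`. -/
def Theta (α : ℂ) (x : V3) : ℂ :=
  -Complex.exp (Complex.I * α * (enorm3 x : ℝ)) / (4 * Real.pi * (enorm3 x : ℝ))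

/-- `𝒦_α(x) = (α + x/|x|² − iα x/|x|) Θ_α(x)`. -/
def Kfun (α : ℂ) (x : V3) : BQ :=
  Theta α x • ((α : BQ) + (((enorm3 x ^ 2)⁻¹ : ℝ) : ℂ) • vecR x
    - (Complex.I * α * ((enorm3 x : ℝ) : ℂ)⁻¹) • vecR x)


def dd (v : ℝ × V3) (f : ℝ × V3 → ℝ) (p : ℝ × V3) : ℝ := fderiv ℝ f p v

theorem dd_smooth (v : ℝ × V3) {f : ℝ × V3 → ℝ} (hf : ContDiff ℝ (⊤ : ℕ∞) f) :
    ContDiff ℝ (⊤ : ℕ∞) (dd v f) := by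
  unfold dd
  exact (hf.fderiv_right (m := (⊤ : ℕ∞)) (by simp)).clm_apply contDiff_const

theorem sm_diff {f : ℝ × V3 → ℝ} (hf : ContDiff ℝ (⊤ : ℕ∞) f) : Differentiable ℝ f :=
  hf.differentiable (by simp)

theorem dd_comm (v w : ℝ × V3) {f : ℝ × V3 → ℝ} (hf : ContDiff ℝ (⊤ : ℕ∞) f) (p : ℝ × V3) :
    dd v (dd w f) p = dd w (dd v f) p := by
  have hd : DifferentiableAt ℝ (fderiv ℝ f) p :=
    ((hf.fderiv_right (m := (⊤ : ℕ∞)) (by simp)).differentiable (by simp)) p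
  have key : ∀ a b : ℝ × V3, dd a (dd b f) p = fderiv ℝ (fderiv ℝ f) p a b := by
    intro a b
    have : HasFDerivAt (fun q => fderiv ℝ f q b) _ p :=
      hd.hasFDerivAt.clm_apply (hasFDerivAt_const b p)
    unfold dd
    rw [this.fderiv]
    simp
  rw [key, key]
  have hs : IsSymmSndFDerivAt ℝ f p := by
    apply (hf.contDiffAt).isSymmSndFDerivAt
    simp only [minSmoothness_of_isRCLikeNormedField]
    exact WithTop.coe_le_coe.2 (le_top : (2 : ℕ∞) ≤ ⊤)
  exact hs v w

theorem dd_add (v : ℝ × V3) {f g : ℝ × V3 → ℝ} (hf : ContDiff ℝ (⊤ : ℕ∞) f)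
    (hg : ContDiff ℝ (⊤ : ℕ∞) g) (p : ℝ × V3) :
    dd v (fun q => f q + g q) p = dd v f p + dd v g p := by
  unfold dd
  rw [fderiv_fun_add (sm_diff hf p) (sm_diff hg p)]; rfl

theorem dd_sub (v : ℝ × V3) {f g : ℝ × V3 → ℝ} (hf : ContDiff ℝ (⊤ : ℕ∞) f)
    (hg : ContDiff ℝ (⊤ : ℕ∞) g) (p : ℝ × V3) :
    dd v (fun q => f q - g q) p = dd v f p - dd v g p := by
  unfold dd
  rw [fderiv_fun_sub (sm_diff hf p) (sm_diff hg p)]; rfl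

theorem dd_mul (v : ℝ × V3) (c : ℝ) {f : ℝ × V3 → ℝ} (hf : ContDiff ℝ (⊤ : ℕ∞) f)
    (p : ℝ × V3) :
    dd v (fun q => c * f q) p = c * dd v f p := by
  unfold dd
  rw [fderiv_const_mul (sm_diff hf p)]; rfl

def sx (k : Fin 3) : ℝ × V3 := (0, Pi.single k 1)

def st : ℝ × V3 := (1, 0)

theorem pdR_eq (k : Fin 3) {f : ℝ × V3 → ℝ} (hf : ContDiff ℝ (⊤ : ℕ∞) f) (p : ℝ × V3) :
    pdR k (fun y => f (p.1, y)) p.2 = dd (sx k) f p := by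
  have h1 : HasFDerivAt (fun y : V3 => (p.1, y)) (ContinuousLinearMap.inr ℝ ℝ V3) p.2 :=
    hasFDerivAt_prodMk_right p.1 p.2
  have h2 : HasFDerivAt f (fderiv ℝ f p) (p.1, p.2) := (sm_diff hf p).hasFDerivAt
  have h3 := h2.comp p.2 h1
  unfold pdR dd sx
  have h4 : fderiv ℝ (fun y => f (p.1, y)) p.2 = _ := h3.fderiv
  rw [h4]; simp

theorem deriv_eq_dd {f : ℝ × V3 → ℝ} (hf : ContDiff ℝ (⊤ : ℕ∞) f) (p : ℝ × V3) :
    deriv (fun s => f (s, p.2)) p.1 = dd st f p := by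
  have h1 : HasFDerivAt (fun y : ℝ => (y, p.2)) (ContinuousLinearMap.inl ℝ ℝ V3) p.1 :=
    hasFDerivAt_prodMk_left p.1 p.2
  have h2 : HasFDerivAt f (fderiv ℝ f p) (p.1, p.2) := (sm_diff hf p).hasFDerivAt
  have h3 := (h2.comp p.1 h1).hasDerivAt
  have h4 : deriv (fun s => f (s, p.2)) p.1 = _ := h3.deriv
  rw [h4]; simp [dd, st]

theorem pdC_eq (k : Fin 3) (c : ℝ) {f g : ℝ × V3 → ℝ} (hf : ContDiff ℝ (⊤ : ℕ∞) f)
    (hg : ContDiff ℝ (⊤ : ℕ∞) g) (p : ℝ × V3) :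
    pdC k (fun y => (f (p.1, y) : ℂ) - Complex.I * (c : ℝ) * (g (p.1, y) : ℂ)) p.2
      = (dd (sx k) f p : ℂ) - Complex.I * (c : ℝ) * (dd (sx k) g p : ℂ) := by
  rw [← pdR_eq k hf, ← pdR_eq k hg]
  have hf' : DifferentiableAt ℝ (fun y => f (p.1, y)) p.2 :=
    (sm_diff hf).comp (by fun_prop : Differentiable ℝ (fun y : V3 => (p.1, y))) p.2
  have hg' : DifferentiableAt ℝ (fun y => g (p.1, y)) p.2 :=
    (sm_diff hg).comp (by fun_prop : Differentiable ℝ (fun y : V3 => (p.1, y))) p.2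
  have h1 := Complex.ofRealCLM.hasFDerivAt.comp p.2 hf'.hasFDerivAt
  have h2 := (Complex.ofRealCLM.hasFDerivAt.comp p.2 hg'.hasFDerivAt).const_mul
    (Complex.I * (c : ℝ))
  have h4 : fderiv ℝ (fun y => (f (p.1, y) : ℂ) - Complex.I * (c : ℝ) * (g (p.1, y) : ℂ)) p.2
    = _ := (h1.sub h2).fderiv
  unfold pdC pdR
  rw [h4]; simp

theorem deriv_eqC (c : ℝ) {f g : ℝ × V3 → ℝ} (hf : ContDiff ℝ (⊤ : ℕ∞) f)
    (hg : ContDiff ℝ (⊤ : ℕ∞) g) (p : ℝ × V3) :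
    deriv (fun s => (f (s, p.2) : ℂ) - Complex.I * (c : ℝ) * (g (s, p.2) : ℂ)) p.1
      = (dd st f p : ℂ) - Complex.I * (c : ℝ) * (dd st g p : ℂ) := by
  rw [← deriv_eq_dd hf, ← deriv_eq_dd hg]
  have hf' : DifferentiableAt ℝ (fun s => f (s, p.2)) p.1 :=
    (sm_diff hf).comp (by fun_prop : Differentiable ℝ (fun s : ℝ => (s, p.2))) p.1
  have hg' : DifferentiableAt ℝ (fun s => g (s, p.2)) p.1 :=
    (sm_diff hg).comp (by fun_prop : Differentiable ℝ (fun s : ℝ => (s, p.2))) p.1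
  exact (hf'.hasDerivAt.ofReal_comp.sub
    (hg'.hasDerivAt.ofReal_comp.const_mul (Complex.I * (c : ℝ)))).deriv

theorem comp_sm {E : ℝ × V3 → V3} (hE : ContDiff ℝ (⊤ : ℕ∞) E) (k : Fin 3) :
    ContDiff ℝ (⊤ : ℕ∞) (fun p => E p k) := contDiff_pi.1 hE k

theorem div3_eq {E : ℝ × V3 → V3} (hE : ContDiff ℝ (⊤ : ℕ∞) E) (p : ℝ × V3) :
    div3 E p = dd (sx 0) (fun p => E p 0) p + dd (sx 1) (fun p => E p 1) p
      + dd (sx 2) (fun p => E p 2) p := by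
  simp only [div3, Fin.sum_univ_three]
  rw [← pdR_eq 0 (comp_sm hE 0), ← pdR_eq 1 (comp_sm hE 1), ← pdR_eq 2 (comp_sm hE 2)]

theorem rot3_eq {E : ℝ × V3 → V3} (hE : ContDiff ℝ (⊤ : ℕ∞) E) (p : ℝ × V3) :
    rot3 E p = ![dd (sx 1) (fun p => E p 2) p - dd (sx 2) (fun p => E p 1) p,
      dd (sx 2) (fun p => E p 0) p - dd (sx 0) (fun p => E p 2) p,
      dd (sx 0) (fun p => E p 1) p - dd (sx 1) (fun p => E p 0) p] := by
  unfold rot3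
  simp only [← pdR_eq _ (comp_sm hE _)]

theorem rot3_sm {E : ℝ × V3 → V3} (hE : ContDiff ℝ (⊤ : ℕ∞) E) :
    ContDiff ℝ (⊤ : ℕ∞) (rot3 E) := by
  rw [contDiff_pi]
  have h : ∀ k i, ContDiff ℝ (⊤ : ℕ∞) (dd (sx k) (fun p => E p i)) :=
    fun k i => dd_smooth _ (comp_sm hE i)
  intro i
  simp only [rot3_eq hE]
  fin_cases i
  · exact (h 1 2).sub (h 2 1)
  · exact (h 2 0).sub (h 0 2)
  · exact (h 0 1).sub (h 1 0)

theorem div3_sm {E : ℝ × V3 → V3} (hE : ContDiff ℝ (⊤ : ℕ∞) E) :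
    ContDiff ℝ (⊤ : ℕ∞) (div3 E) := by
  have h : ∀ k i, ContDiff ℝ (⊤ : ℕ∞) (dd (sx k) (fun p => E p i)) :=
    fun k i => dd_smooth _ (comp_sm hE i)
  rw [funext (div3_eq hE)]
  exact ((h 0 0).add (h 1 1)).add (h 2 2)

theorem ptV_eq {E : ℝ × V3 → V3} (hE : ContDiff ℝ (⊤ : ℕ∞) E) (p : ℝ × V3) (k : Fin 3) :
    ptV E p k = dd st (fun p => E p k) p := by
  unfold ptV
  rw [← deriv_eq_dd (comp_sm hE k), deriv_pi]
  intro i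
  exact (sm_diff (comp_sm hE i)).comp
    (by fun_prop : Differentiable ℝ (fun s : ℝ => (s, p.2))) p.1

theorem ptV_sm {E : ℝ × V3 → V3} (hE : ContDiff ℝ (⊤ : ℕ∞) E) :
    ContDiff ℝ (⊤ : ℕ∞) (ptV E) := by
  rw [contDiff_pi]
  intro i
  simp only [ptV_eq hE]
  exact dd_smooth _ (comp_sm hE i)

theorem div_rot {E : ℝ × V3 → V3} (hE : ContDiff ℝ (⊤ : ℕ∞) E) (p : ℝ × V3) :
    div3 (rot3 E) p = 0 := by
  have h : ∀ k i, ContDiff ℝ (⊤ : ℕ∞) (dd (sx k) (fun p => E p i)) :=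
    fun k i => dd_smooth _ (comp_sm hE i)
  rw [div3_eq (rot3_sm hE)]
  simp only [rot3_eq hE, Matrix.cons_val]
  rw [dd_sub _ (h _ _) (h _ _), dd_sub _ (h _ _) (h _ _), dd_sub _ (h _ _) (h _ _),
    dd_comm (sx 1) (sx 0) (comp_sm hE _), dd_comm (sx 2) (sx 0) (comp_sm hE _),
    dd_comm (sx 2) (sx 1) (comp_sm hE _)]
  ring

theorem div_ptV {E : ℝ × V3 → V3} (hE : ContDiff ℝ (⊤ : ℕ∞) E) (p : ℝ × V3) :
    div3 (ptV E) p = dd st (div3 E) p := by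
  have h : ∀ k i, ContDiff ℝ (⊤ : ℕ∞) (dd (sx k) (fun p => E p i)) :=
    fun k i => dd_smooth _ (comp_sm hE i)
  rw [div3_eq (ptV_sm hE), funext (div3_eq hE), dd_add _ ((h 0 0).add (h 1 1)) (h 2 2),
    dd_add _ (h 0 0) (h 1 1)]
  simp only [ptV_eq hE]
  have e : ∀ k, dd (sx k) (fun p => dd st (fun p => E p k) p) p
    = dd st (dd (sx k) (fun p => E p k)) p := fun k => dd_comm _ _ (comp_sm hE k) p
  rw [e, e, e]

theorem div_lin (a b : ℝ) {A B : ℝ × V3 → V3} (hA : ContDiff ℝ (⊤ : ℕ∞) A)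
    (hB : ContDiff ℝ (⊤ : ℕ∞) B) (p : ℝ × V3) :
    div3 (fun q => a • A q + b • B q) p = a * div3 A p + b * div3 B p := by
  rw [div3_eq hA, div3_eq hB, div3_eq ((hA.const_smul a).add (hB.const_smul b))]
  simp only [Pi.add_apply, Pi.smul_apply, smul_eq_mul]
  have e : ∀ k, dd (sx k) (fun q => a * A q k + b * B q k) p
      = a * dd (sx k) (fun q => A q k) p + b * dd (sx k) (fun q => B q k) p := by
    intro k
    rw [dd_add _ (contDiff_const.mul (comp_sm hA k)) (contDiff_const.mul (comp_sm hB k)),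
      dd_mul _ _ (comp_sm hA k), dd_mul _ _ (comp_sm hB k)]
  rw [e, e, e]
  ring

theorem pdC_zero (k : Fin 3) (x : V3) : pdC k (fun _ => 0) x = 0 := by
  simp [pdC]

theorem bq_re (s : ℂ) (v : Fin 3 → ℂ) : (bq s v).re = s := rfl
theorem bq_imI (s : ℂ) (v : Fin 3 → ℂ) : (bq s v).imI = v 0 := rfl
theorem bq_imJ (s : ℂ) (v : Fin 3 → ℂ) : (bq s v).imJ = v 1 := rfl
theorem bq_imK (s : ℂ) (v : Fin 3 → ℂ) : (bq s v).imK = v 2 := rfl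

theorem BQ_iff (x y : BQ) : x = y ↔
    x.re = y.re ∧ x.imI = y.imI ∧ x.imJ = y.imJ ∧ x.imK = y.imK :=
  ⟨fun h => by subst h; simp, fun h => Quaternion.ext _ _ h.1 h.2.1 h.2.2.1 h.2.2.2⟩

theorem qi0 : qi 0 = bq 0 ![1, 0, 0] := rfl
theorem qi1 : qi 1 = bq 0 ![0, 1, 0] := rfl
theorem qi2 : qi 2 = bq 0 ![0, 0, 1] := rfl

theorem pdQ_bq (k : Fin 3) (F : V3 → BQ) (x : V3) : pdQ k F x =
    bq (pdC k (fun y => (F y).re) x) ![pdC k (fun y => (F y).imI) x,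
      pdC k (fun y => (F y).imJ) x, pdC k (fun y => (F y).imK) x] := rfl

theorem DQ_eq (c : ℝ) {E H : ℝ × V3 → V3} (hE : ContDiff ℝ (⊤ : ℕ∞) E)
    (hH : ContDiff ℝ (⊤ : ℕ∞) H) (p : ℝ × V3) :
    DQ (fun p => vecC (fun k => (E p k : ℂ) - Complex.I * (c : ℝ) * (H p k : ℂ))) p
      = bq (-((div3 E p : ℂ) - Complex.I * (c : ℝ) * (div3 H p : ℂ)))
        (fun k => (rot3 E p k : ℂ) - Complex.I * (c : ℝ) * (rot3 H p k : ℂ)) := by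
  have e : ∀ k i, pdC k (fun y => (E (p.1, y) i : ℂ)
      - Complex.I * (c : ℝ) * (H (p.1, y) i : ℂ)) p.2 = _ :=
    fun k i => pdC_eq k c (comp_sm hE i) (comp_sm hH i) p
  rw [rot3_eq hE, rot3_eq hH, div3_eq hE, div3_eq hH]
  unfold DQ Dop
  simp only [pdQ_bq, vecC, qi0, qi1, qi2, bq_re, bq_imI, bq_imJ, bq_imK, e, pdC_zero]
  rw [BQ_iff]
  refine ⟨?_, ?_, ?_, ?_⟩ <;>
    simp [bq_re, bq_imI, bq_imJ, bq_imK] <;> ring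

theorem ptQ_eq (c : ℝ) {a b : ℝ × V3 → ℝ} {E H : ℝ × V3 → V3} 
    (ha : ContDiff ℝ (⊤ : ℕ∞) a) (hb : ContDiff ℝ (⊤ : ℕ∞) b) (hE : ContDiff ℝ (⊤ : ℕ∞) E)
    (hH : ContDiff ℝ (⊤ : ℕ∞) H) (p : ℝ × V3) :
    ptQ (fun p => bq (-((a p : ℂ) - Complex.I * (c : ℝ) * (b p : ℂ)))
      (fun k => (E p k : ℂ) - Complex.I * (c : ℝ) * (H p k : ℂ))) p
      = bq (-((dd st a p : ℂ) - Complex.I * (c : ℝ) * (dd st b p : ℂ)))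
        (fun k => (ptV E p k : ℂ) - Complex.I * (c : ℝ) * (ptV H p k : ℂ)) := by
  have e : ∀ i, deriv (fun s => (E (s, p.2) i : ℂ)
      - Complex.I * (c : ℝ) * (H (s, p.2) i : ℂ)) p.1 = _ :=
    fun i => deriv_eqC c (comp_sm hE i) (comp_sm hH i) p
  simp only [ptV_eq hE, ptV_eq hH]
  unfold ptQ bq
  simp only [e, deriv.fun_neg, deriv_eqC c ha hb p]
  rfl

/-- Equivalence of the chiral Maxwell system with the single
quaternionic equation `M V = −√(μ/ε) j − β√(μ/ε) ∂ₜρ + i ρ/ε`, where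
`V = E − i√(μ/ε) H`. -/
theorem maxwell_chiral_iff_quaternionic
    (ε μ β : ℝ) (hε : 0 < ε) (hμ : 0 < μ)
    (E H j : ℝ × V3 → V3) (ρ : ℝ × V3 → ℝ)
    (hE : ContDiff ℝ (⊤ : ℕ∞) E) (hH : ContDiff ℝ (⊤ : ℕ∞) H)
    (hj : ContDiff ℝ (⊤ : ℕ∞) j) (hρ : ContDiff ℝ (⊤ : ℕ∞) ρ)
    (hcont : ∀ p : ℝ × V3, ptR ρ p + div3 j p = 0)
    (V : ℝ × V3 → BQ)
    (hV : V = fun p => vecC (fun k => (E p k : ℂ)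
      - Complex.I * (Real.sqrt (μ / ε) : ℝ) * (H p k : ℂ))) :
    ((∀ p : ℝ × V3, rot3 H p = ε • (ptV E p + β • ptV (rot3 E) p) + j p) ∧
     (∀ p : ℝ × V3, rot3 E p = -(μ • (ptV H p + β • ptV (rot3 H) p))) ∧
     (∀ p : ℝ × V3, div3 E p = ρ p / ε) ∧
     (∀ p : ℝ × V3, div3 H p = 0)) ↔
    (∀ p : ℝ × V3, Mop ε μ β V p =
      bq (((-β * Real.sqrt (μ / ε) * ptR ρ p : ℝ) : ℂ)
            + Complex.I * ((ρ p : ℝ) : ℂ) / ((ε : ℝ) : ℂ))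
         (fun k => ((-Real.sqrt (μ / ε) * j p k : ℝ) : ℂ))) := by
  subst hV
  set c := Real.sqrt (μ / ε) with hc
  set a := Real.sqrt (ε * μ) with ha
  have hcpos : 0 < c := Real.sqrt_pos.2 (div_pos hμ hε)
  have hac : a = ε * c := by
    rw [ha, hc, show ε * μ = ε ^ 2 * (μ / ε) by field_simp, Real.sqrt_mul (by positivity),
      Real.sqrt_sq hε.le]
  have hcc : ε * c * c = μ := by
    rw [mul_assoc, hc, Real.mul_self_sqrt (by positivity)]; field_simp
  have hpt : ∀ p, ptR ρ p = dd st ρ p := fun p => deriv_eq_dd hρ p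
  have hzero : ∀ p, ptQ (fun p => vecC (fun k => (E p k : ℂ)
      - Complex.I * (c : ℝ) * (H p k : ℂ))) p = vecC
        (fun k => (ptV E p k : ℂ) - Complex.I * (c : ℝ) * (ptV H p k : ℂ)) := by
    intro p
    have := ptQ_eq c (a := fun _ => 0) (b := fun _ => 0) contDiff_const contDiff_const hE hH p
    simpa [dd, vecC] using this
  have hM : ∀ p, (Mop ε μ β (fun p => vecC (fun k => (E p k : ℂ)
      - Complex.I * (c : ℝ) * (H p k : ℂ))) p =
      bq (((-β * c * ptR ρ p : ℝ) : ℂ)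
            + Complex.I * ((ρ p : ℝ) : ℂ) / ((ε : ℝ) : ℂ))
         (fun k => ((-c * j p k : ℝ) : ℂ))) ↔
      ((-β * a * dd st (div3 E) p + c * div3 H p = -β * c * dd st ρ p ∧
       β * a * c * dd st (div3 H) p + div3 E p = ρ p / ε) ∧
       ∀ k, (β * a * ptV (rot3 E) p k + a * ptV E p k - c * rot3 H p k = -c * j p k ∧
         - (β * a * c * ptV (rot3 H) p k) - a * c * ptV H p k - rot3 E p k = 0)) := by
    intro p
    unfold Mop
    rw [hzero, funext (DQ_eq c hE hH),
      ptQ_eq c (div3_sm hE) (div3_sm hH) (rot3_sm hE) (rot3_sm hH), hpt, ← ha]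
    have hdiv : Complex.I * ((ρ p : ℝ) : ℂ) / ((ε : ℝ) : ℂ)
      = Complex.I * ((ρ p / ε : ℝ) : ℂ) := by push_cast; ring
    rw [hdiv]
    generalize ρ p / ε = r
    clear_value a c
    rw [BQ_iff]
    simp only [Complex.ext_iff, vecC]
    simp [bq_re, bq_imI, bq_imJ, bq_imK, Fin.forall_fin_succ]
    grind
  simp only [hM]
  have v1 : (∀ p : ℝ × V3, rot3 H p = ε • (ptV E p + β • ptV (rot3 E) p) + j p) ↔
      ∀ p k, β * a * ptV (rot3 E) p k + a * ptV E p k - c * rot3 H p k = -c * j p k := by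
    refine forall_congr' fun p => ?_
    rw [funext_iff]
    refine forall_congr' fun k => ?_
    simp only [Pi.add_apply, Pi.smul_apply, smul_eq_mul, hac]
    constructor
    · intro h; rw [h]; ring
    · intro h
      apply mul_left_cancel₀ hcpos.ne'
      linarith
  have v2 : (∀ p : ℝ × V3, rot3 E p = -(μ • (ptV H p + β • ptV (rot3 H) p))) ↔
      ∀ p k, - (β * a * c * ptV (rot3 H) p k) - a * c * ptV H p k - rot3 E p k = 0 := by
    refine forall_congr' fun p => ?_
    rw [funext_iff]
    refine forall_congr' fun k => ?_
    simp only [Pi.add_apply, Pi.smul_apply, smul_eq_mul, hac, Pi.neg_apply]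
    rw [← hcc]
    constructor
    · intro h; rw [h]; ring
    · intro h; linarith
  constructor
  · rintro ⟨h1, h2, h3, h4⟩ p
    refine ⟨⟨?_, ?_⟩, fun k => ⟨v1.1 h1 p k, v2.1 h2 p k⟩⟩
    · have : div3 E = fun q => ε⁻¹ * ρ q := by
        funext q; rw [h3]; ring
      rw [this, dd_mul _ _ hρ, h4, hac]
      field_simp
      ring
    · have : div3 H = fun q => 0 := funext h4
      rw [this, h3]
      simp [dd]
  · intro h
    have h2 := v2.2 fun p k => ((h p).2 k).2
    have hd : ∀ p, dd st (div3 H) p = 0 := by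
      intro p
      have e : rot3 E = fun q => (-μ) • ptV H q + (-(μ * β)) • ptV (rot3 H) q := by
        funext q
        rw [h2 q]
        module
      have z := div_rot hE p
      rw [e, div_lin _ _ (ptV_sm hH) (ptV_sm (rot3_sm hH)), div_ptV hH,
        div_ptV (rot3_sm hH), funext (div_rot hH)] at z
      have z' : dd st (fun _ => 0) p = 0 := by simp [dd]
      rw [z'] at z
      have : μ * dd st (div3 H) p = 0 := by linarith
      exact (mul_eq_zero.1 this).resolve_left hμ.ne'
    have h3 : ∀ p, div3 E p = ρ p / ε := by
      intro p
      have := (h p).1.2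
      rw [hd p] at this
      linarith
    refine ⟨v1.2 fun p k => ((h p).2 k).1, h2, h3, ?_⟩
    intro p
    have := (h p).1.1
    have e : div3 E = fun q => ε⁻¹ * ρ q := by
      funext q; rw [h3]; ring
    rw [e, dd_mul _ _ hρ, hac] at this
    have e2 : -β * (ε * c) * (ε⁻¹ * dd st ρ p) = -β * c * dd st ρ p := by field_simp
    rw [e2] at this
    have : c * div3 H p = 0 := by linarith
    exact (mul_eq_zero.1 this).resolve_left hcpos.ne'
end
end

section
/- Let ε, μ > 0 and β ∈ ℝ. Suppose smooth (C⁴) vector fields E, H : ℝ × ℝ³ → ℝ³ solve the sourceless chiral Maxwell system: rot H = ε(∂ₜE + β ∂ₜ rot E); rot E = −μ(∂ₜH + β ∂ₜ rot H); div E = 0; div H = 0. Then, viewing E and H as purely vectorial biquaternion-valued functions, M M* E = 0 and M M* H = 0. -/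
noncomputable section

/-- componentwise directional derivative -/
def dQ (v : ℝ × V3) (F : ℝ × V3 → BQ) (p : ℝ × V3) : BQ :=
  ⟨fderiv ℝ (fun q => (F q).re) p v, fderiv ℝ (fun q => (F q).imI) p v,
   fderiv ℝ (fun q => (F q).imJ) p v, fderiv ℝ (fun q => (F q).imK) p v⟩

lemma dQ_re (v : ℝ × V3) (F : ℝ × V3 → BQ) (p) :
    (dQ v F p).re = fderiv ℝ (fun q => (F q).re) p v := rfl
lemma dQ_imI (v : ℝ × V3) (F : ℝ × V3 → BQ) (p) :
    (dQ v F p).imI = fderiv ℝ (fun q => (F q).imI) p v := rfl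
lemma dQ_imJ (v : ℝ × V3) (F : ℝ × V3 → BQ) (p) :
    (dQ v F p).imJ = fderiv ℝ (fun q => (F q).imJ) p v := rfl
lemma dQ_imK (v : ℝ × V3) (F : ℝ × V3 → BQ) (p) :
    (dQ v F p).imK = fderiv ℝ (fun q => (F q).imK) p v := rfl

lemma bq_mul_smul (z : ℂ) (a b : BQ) : a * z • b = z • (a * b) := by
  ext <;> simp <;> ring

lemma qi0_re (q : BQ) : (qi 0 * q).re = -q.imI := by
  have e : (qi 0).re = 0 ∧ (qi 0).imI = 1 ∧ (qi 0).imJ = 0 ∧ (qi 0).imK = 0 :=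
    ⟨rfl, rfl, rfl, rfl⟩
  simp [e]
lemma qi0_imI (q : BQ) : (qi 0 * q).imI = q.re := by
  have e : (qi 0).re = 0 ∧ (qi 0).imI = 1 ∧ (qi 0).imJ = 0 ∧ (qi 0).imK = 0 :=
    ⟨rfl, rfl, rfl, rfl⟩
  simp [e]
lemma qi0_imJ (q : BQ) : (qi 0 * q).imJ = -q.imK := by
  have e : (qi 0).re = 0 ∧ (qi 0).imI = 1 ∧ (qi 0).imJ = 0 ∧ (qi 0).imK = 0 :=
    ⟨rfl, rfl, rfl, rfl⟩
  simp [e]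
lemma qi0_imK (q : BQ) : (qi 0 * q).imK = q.imJ := by
  have e : (qi 0).re = 0 ∧ (qi 0).imI = 1 ∧ (qi 0).imJ = 0 ∧ (qi 0).imK = 0 :=
    ⟨rfl, rfl, rfl, rfl⟩
  simp [e]
lemma qi1_re (q : BQ) : (qi 1 * q).re = -q.imJ := by
  have e : (qi 1).re = 0 ∧ (qi 1).imI = 0 ∧ (qi 1).imJ = 1 ∧ (qi 1).imK = 0 :=
    ⟨rfl, rfl, rfl, rfl⟩
  simp [e]
lemma qi1_imI (q : BQ) : (qi 1 * q).imI = q.imK := by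
  have e : (qi 1).re = 0 ∧ (qi 1).imI = 0 ∧ (qi 1).imJ = 1 ∧ (qi 1).imK = 0 :=
    ⟨rfl, rfl, rfl, rfl⟩
  simp [e]
lemma qi1_imJ (q : BQ) : (qi 1 * q).imJ = q.re := by
  have e : (qi 1).re = 0 ∧ (qi 1).imI = 0 ∧ (qi 1).imJ = 1 ∧ (qi 1).imK = 0 :=
    ⟨rfl, rfl, rfl, rfl⟩
  simp [e]
lemma qi1_imK (q : BQ) : (qi 1 * q).imK = -q.imI := by
  have e : (qi 1).re = 0 ∧ (qi 1).imI = 0 ∧ (qi 1).imJ = 1 ∧ (qi 1).imK = 0 :=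
    ⟨rfl, rfl, rfl, rfl⟩
  simp [e]
lemma qi2_re (q : BQ) : (qi 2 * q).re = -q.imK := by
  have e : (qi 2).re = 0 ∧ (qi 2).imI = 0 ∧ (qi 2).imJ = 0 ∧ (qi 2).imK = 1 :=
    ⟨rfl, rfl, rfl, rfl⟩
  simp [e]
lemma qi2_imI (q : BQ) : (qi 2 * q).imI = -q.imJ := by
  have e : (qi 2).re = 0 ∧ (qi 2).imI = 0 ∧ (qi 2).imJ = 0 ∧ (qi 2).imK = 1 :=
    ⟨rfl, rfl, rfl, rfl⟩
  simp [e]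
lemma qi2_imJ (q : BQ) : (qi 2 * q).imJ = q.imI := by
  have e : (qi 2).re = 0 ∧ (qi 2).imI = 0 ∧ (qi 2).imJ = 0 ∧ (qi 2).imK = 1 :=
    ⟨rfl, rfl, rfl, rfl⟩
  simp [e]
lemma qi2_imK (q : BQ) : (qi 2 * q).imK = q.re := by
  have e : (qi 2).re = 0 ∧ (qi 2).imI = 0 ∧ (qi 2).imJ = 0 ∧ (qi 2).imK = 1 :=
    ⟨rfl, rfl, rfl, rfl⟩
  simp [e]
lemma pdQ_re (k F x) : (pdQ k F x).re = pdC k (fun y => (F y).re) x := rfl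
lemma pdQ_imI (k F x) : (pdQ k F x).imI = pdC k (fun y => (F y).imI) x := rfl
lemma pdQ_imJ (k F x) : (pdQ k F x).imJ = pdC k (fun y => (F y).imJ) x := rfl
lemma pdQ_imK (k F x) : (pdQ k F x).imK = pdC k (fun y => (F y).imK) x := rfl
lemma vecR_re (v : V3) : (vecR v).re = 0 := rfl
lemma vecR_imI (v : V3) : (vecR v).imI = (v 0 : ℂ) := rfl
lemma vecR_imJ (v : V3) : (vecR v).imJ = (v 1 : ℂ) := rfl
lemma vecR_imK (v : V3) : (vecR v).imK = (v 2 : ℂ) := rfl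

def CQ (n : ℕ) (F : ℝ × V3 → BQ) : Prop :=
  ContDiff ℝ n (fun p => (F p).re) ∧ ContDiff ℝ n (fun p => (F p).imI) ∧
  ContDiff ℝ n (fun p => (F p).imJ) ∧ ContDiff ℝ n (fun p => (F p).imK)

lemma CQ.mono {n m : ℕ} {F : ℝ × V3 → BQ} (h : CQ n F) (hm : m ≤ n) : CQ m F := by
  have hm' : (m : WithTop ℕ∞) ≤ n := by exact_mod_cast hm
  exact ⟨h.1.of_le hm', h.2.1.of_le hm', h.2.2.1.of_le hm', h.2.2.2.of_le hm'⟩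

lemma CQ.diff {n : ℕ} {F : ℝ × V3 → BQ} (h : CQ n F) (hn : 1 ≤ n) :
    Differentiable ℝ (fun p => (F p).re) ∧ Differentiable ℝ (fun p => (F p).imI) ∧
    Differentiable ℝ (fun p => (F p).imJ) ∧ Differentiable ℝ (fun p => (F p).imK) := by
  obtain ⟨a, b, c, d⟩ := h.mono hn
  exact ⟨a.differentiable (by simp), b.differentiable (by simp),
    c.differentiable (by simp), d.differentiable (by simp)⟩

lemma contDiff_dir {n : ℕ} {f : ℝ × V3 → ℂ} (h : ContDiff ℝ (n + 1 : ℕ) f) (v : ℝ × V3) :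
    ContDiff ℝ n (fun p => fderiv ℝ f p v) :=
  (h.fderiv_right (m := n) (by push_cast; exact le_rfl)).clm_apply contDiff_const

lemma CQ.dQ {n : ℕ} {F : ℝ × V3 → BQ} (h : CQ (n + 1) F) (v : ℝ × V3) : CQ n (dQ v F) :=
  ⟨contDiff_dir h.1 v, contDiff_dir h.2.1 v, contDiff_dir h.2.2.1 v, contDiff_dir h.2.2.2 v⟩

lemma CQ.add {n : ℕ} {F G : ℝ × V3 → BQ} (h : CQ n F) (h' : CQ n G) :
    CQ n (fun p => F p + G p) := by
  obtain ⟨a, b, c, d⟩ := h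
  obtain ⟨a', b', c', d'⟩ := h'
  exact ⟨a.add a', b.add b', c.add c', d.add d'⟩

lemma CQ.smul {n : ℕ} {F : ℝ × V3 → BQ} (h : CQ n F) (z : ℂ) :
    CQ n (fun p => z • F p) := by
  obtain ⟨a, b, c, d⟩ := h
  exact ⟨contDiff_const.mul a, contDiff_const.mul b, contDiff_const.mul c, contDiff_const.mul d⟩

lemma CQ.mul {n : ℕ} {F : ℝ × V3 → BQ} (h : CQ n F) (z : BQ) :
    CQ n (fun p => z * F p) := by
  obtain ⟨a, b, c, d⟩ := h
  unfold CQ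
  simp only [Quaternion.re_mul, Quaternion.imI_mul, Quaternion.imJ_mul, Quaternion.imK_mul]
  refine ⟨?_, ?_, ?_, ?_⟩ <;> fun_prop

lemma dQ_add {F G : ℝ × V3 → BQ} (h : CQ 1 F) (h' : CQ 1 G) (v p) :
    dQ v (fun p => F p + G p) p = dQ v F p + dQ v G p := by
  obtain ⟨a, b, c, d⟩ := h.diff le_rfl
  obtain ⟨a', b', c', d'⟩ := h'.diff le_rfl
  ext
  · simp only [dQ_re, Quaternion.re_add]; rw [fderiv_fun_add (a p) (a' p)]; rfl
  · simp only [dQ_imI, Quaternion.imI_add]; rw [fderiv_fun_add (b p) (b' p)]; rfl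
  · simp only [dQ_imJ, Quaternion.imJ_add]; rw [fderiv_fun_add (c p) (c' p)]; rfl
  · simp only [dQ_imK, Quaternion.imK_add]; rw [fderiv_fun_add (d p) (d' p)]; rfl

lemma dQ_smul {F : ℝ × V3 → BQ} (h : CQ 1 F) (z : ℂ) (v p) :
    dQ v (fun p => z • F p) p = z • dQ v F p := by
  obtain ⟨a, b, c, d⟩ := h.diff le_rfl
  ext
  · simp only [dQ_re, Quaternion.re_smul, smul_eq_mul]; rw [fderiv_const_mul (a p)]; rfl
  · simp only [dQ_imI, Quaternion.imI_smul, smul_eq_mul]; rw [fderiv_const_mul (b p)]; rfl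
  · simp only [dQ_imJ, Quaternion.imJ_smul, smul_eq_mul]; rw [fderiv_const_mul (c p)]; rfl
  · simp only [dQ_imK, Quaternion.imK_smul, smul_eq_mul]; rw [fderiv_const_mul (d p)]; rfl

lemma dQ_mul {F : ℝ × V3 → BQ} (h : CQ 1 F) (z : BQ) (v p) :
    dQ v (fun p => z * F p) p = z * dQ v F p := by
  obtain ⟨a, b, c, d⟩ := h.diff le_rfl
  have ha := (a p).hasFDerivAt
  have hb := (b p).hasFDerivAt
  have hc := (c p).hasFDerivAt
  have hd := (d p).hasFDerivAt
  ext
  · simp only [dQ_re, dQ_imI, dQ_imJ, dQ_imK, Quaternion.re_mul]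
    rw [((((ha.const_mul z.re).fun_sub (hb.const_mul z.imI)).fun_sub (hc.const_mul z.imJ)).fun_sub
      (hd.const_mul z.imK)).fderiv]
    rfl
  · simp only [dQ_re, dQ_imI, dQ_imJ, dQ_imK, Quaternion.imI_mul]
    rw [((((hb.const_mul z.re).fun_add (ha.const_mul z.imI)).fun_add (hd.const_mul z.imJ)).fun_sub
      (hc.const_mul z.imK)).fderiv]
    rfl
  · simp only [dQ_re, dQ_imI, dQ_imJ, dQ_imK, Quaternion.imJ_mul]
    rw [((((hc.const_mul z.re).fun_sub (hd.const_mul z.imI)).fun_add (ha.const_mul z.imJ)).fun_add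
      (hb.const_mul z.imK)).fderiv]
    rfl
  · simp only [dQ_re, dQ_imI, dQ_imJ, dQ_imK, Quaternion.imK_mul]
    rw [((((hd.const_mul z.re).fun_add (hc.const_mul z.imI)).fun_sub (hb.const_mul z.imJ)).fun_add
      (ha.const_mul z.imK)).fderiv]
    rfl

lemma dir_comm {f : ℝ × V3 → ℂ} (h : ContDiff ℝ 2 f) (v w p) :
    fderiv ℝ (fun q => fderiv ℝ f q v) p w = fderiv ℝ (fun q => fderiv ℝ f q w) p v := by
  have hs : IsSymmSndFDerivAt ℝ f p :=
    h.contDiffAt.isSymmSndFDerivAt (by simp)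
  have hd : DifferentiableAt ℝ (fderiv ℝ f) p :=
    (h.fderiv_right (m := 1) (by norm_num)).differentiable (by simp) p
  rw [fderiv_clm_apply hd (by fun_prop), fderiv_clm_apply hd (by fun_prop)]
  simpa using hs.eq w v

lemma dQ_comm {F : ℝ × V3 → BQ} (h : CQ 2 F) (v w p) :
    dQ w (dQ v F) p = dQ v (dQ w F) p := by
  obtain ⟨a, b, c, d⟩ := h
  unfold dQ
  ext
  · exact dir_comm a v w p
  · exact dir_comm b v w p
  · exact dir_comm c v w p
  · exact dir_comm d v w p

lemma slice_t {f : ℝ × V3 → ℂ} (h : Differentiable ℝ f) (p : ℝ × V3) :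
    deriv (fun s => f (s, p.2)) p.1 = fderiv ℝ f p (1, 0) := by
  have h1 : HasDerivAt (fun s : ℝ => ((s, p.2) : ℝ × V3)) (1, 0) p.1 :=
    (hasDerivAt_id _).prodMk (hasDerivAt_const _ _)
  exact ((h (p.1, p.2)).hasFDerivAt.comp_hasDerivAt p.1 h1).deriv

lemma slice_x {f : ℝ × V3 → ℂ} (h : Differentiable ℝ f) (k : Fin 3) (p : ℝ × V3) :
    pdC k (fun y => f (p.1, y)) p.2 = fderiv ℝ f p (0, Pi.single k 1) := by
  have h1 : HasFDerivAt (fun y : V3 => ((p.1, y) : ℝ × V3))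
      ((0 : V3 →L[ℝ] ℝ).prod (ContinuousLinearMap.id ℝ V3)) p.2 :=
    (hasFDerivAt_const _ _).prodMk (hasFDerivAt_id _)
  have := ((h (p.1, p.2)).hasFDerivAt.comp p.2 h1).fderiv
  unfold pdC
  have h2 : (fun y => f (p.1, y)) = f ∘ (fun y : V3 => ((p.1, y) : ℝ × V3)) := rfl
  rw [h2, this]
  rfl

def eT : ℝ × V3 := (1, 0)
def eX (k : Fin 3) : ℝ × V3 := (0, Pi.single k 1)

lemma ptQ_eq_s8 {F : ℝ × V3 → BQ} (h : CQ 1 F) : ptQ F = dQ eT F := by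
  obtain ⟨a, b, c, d⟩ := h.diff le_rfl
  funext p
  unfold ptQ dQ
  rw [slice_t a, slice_t b, slice_t c, slice_t d]; rfl

lemma DQ_eq_s8 {F : ℝ × V3 → BQ} (h : CQ 1 F) :
    DQ F = fun p => qi 0 * dQ (eX 0) F p + qi 1 * dQ (eX 1) F p + qi 2 * dQ (eX 2) F p := by
  obtain ⟨a, b, c, d⟩ := h.diff le_rfl
  funext p
  unfold DQ Dop pdQ dQ
  simp only [slice_x a, slice_x b, slice_x c, slice_x d]; rfl

lemma CQ.ptQ {n : ℕ} {F : ℝ × V3 → BQ} (h : CQ (n + 1) F) : CQ n (ptQ F) := by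
  rw [ptQ_eq_s8 (h.mono (by omega))]; exact h.dQ _

lemma CQ.DQ {n : ℕ} {F : ℝ × V3 → BQ} (h : CQ (n + 1) F) : CQ n (DQ F) := by
  rw [DQ_eq_s8 (h.mono (by omega))]
  exact (((h.dQ _).mul _).add ((h.dQ _).mul _)).add ((h.dQ _).mul _)

lemma ptQ_add {F G : ℝ × V3 → BQ} (h : CQ 1 F) (h' : CQ 1 G) :
    ptQ (fun p => F p + G p) = fun p => ptQ F p + ptQ G p := by
  rw [ptQ_eq_s8 h, ptQ_eq_s8 h', ptQ_eq_s8 (h.add h')]; funext p; exact dQ_add h h' _ _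

lemma ptQ_smul {F : ℝ × V3 → BQ} (h : CQ 1 F) (z : ℂ) :
    ptQ (fun p => z • F p) = fun p => z • ptQ F p := by
  rw [ptQ_eq_s8 h, ptQ_eq_s8 (h.smul z)]; funext p; exact dQ_smul h _ _ _

lemma DQ_add {F G : ℝ × V3 → BQ} (h : CQ 1 F) (h' : CQ 1 G) :
    DQ (fun p => F p + G p) = fun p => DQ F p + DQ G p := by
  rw [DQ_eq_s8 h, DQ_eq_s8 h', DQ_eq_s8 (h.add h')]; funext p
  simp only [dQ_add h h', mul_add]; abel

lemma DQ_smul {F : ℝ × V3 → BQ} (h : CQ 1 F) (z : ℂ) :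
    DQ (fun p => z • F p) = fun p => z • DQ F p := by
  rw [DQ_eq_s8 h, DQ_eq_s8 (h.smul z)]; funext p
  simp only [dQ_smul h, bq_mul_smul, smul_add]

lemma DQ_ptQ {F : ℝ × V3 → BQ} (h : CQ 2 F) : DQ (ptQ F) = ptQ (DQ F) := by
  have h1 : CQ 1 F := h.mono (by omega)
  have hd : ∀ v, CQ 1 (dQ v F) := fun v => CQ.dQ (n := 1) h v
  rw [DQ_eq_s8 (CQ.ptQ (n := 1) h), ptQ_eq_s8 (CQ.DQ (n := 1) h), ptQ_eq_s8 h1, DQ_eq_s8 h1]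
  funext p
  rw [dQ_add (((hd _).mul _).add ((hd _).mul _)) ((hd _).mul _),
    dQ_add ((hd _).mul _) ((hd _).mul _), dQ_mul (hd _), dQ_mul (hd _), dQ_mul (hd _)]
  simp only [dQ_comm h eT]

def AQ (β : ℝ) (F : ℝ × V3 → BQ) (p : ℝ × V3) : BQ := ptQ F p + (β : ℂ) • ptQ (DQ F) p

lemma CQ.AQ {n : ℕ} {β : ℝ} {F : ℝ × V3 → BQ} (h : CQ (n + 2) F) : CQ n (AQ β F) :=
  (CQ.ptQ (h.mono (by omega))).add ((CQ.ptQ (CQ.DQ h)).smul _)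

lemma AQ_add {β : ℝ} {F G : ℝ × V3 → BQ} (h : CQ 2 F) (h' : CQ 2 G) :
    AQ β (fun p => F p + G p) = fun p => AQ β F p + AQ β G p := by
  have h1 : CQ 1 F := h.mono (by omega)
  have h1' : CQ 1 G := h'.mono (by omega)
  funext p
  unfold AQ
  rw [DQ_add h1 h1', ptQ_add h1 h1', ptQ_add (CQ.DQ h) (CQ.DQ h')]
  simp only [smul_add]; abel

lemma AQ_smul {β : ℝ} {F : ℝ × V3 → BQ} (h : CQ 2 F) (z : ℂ) :
    AQ β (fun p => z • F p) = fun p => z • AQ β F p := by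
  have h1 : CQ 1 F := h.mono (by omega)
  funext p
  unfold AQ
  rw [DQ_smul h1, ptQ_smul h1, ptQ_smul (CQ.DQ h)]
  simp only [smul_add, smul_comm z]

lemma DQ_AQ {β : ℝ} {F : ℝ × V3 → BQ} (h : CQ 3 F) : DQ (AQ β F) = AQ β (DQ F) := by
  have h2 : CQ 2 F := h.mono (by omega)
  have hD : CQ 2 (DQ F) := CQ.DQ h
  have : AQ β F = fun p => ptQ F p + (β : ℂ) • ptQ (DQ F) p := rfl
  rw [this, DQ_add (CQ.ptQ h2) ((CQ.ptQ hD).smul _), DQ_smul (CQ.ptQ hD), DQ_ptQ h2, DQ_ptQ hD]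
  rfl

lemma core (ε μ β : ℝ) (hε : 0 < ε) (hμ : 0 < μ) (F G : ℝ × V3 → BQ) (hF : CQ 4 F) (hG : CQ 4 G)
    (a b : ℂ) (hab : a * b = -(ε * μ : ℝ))
    (h1 : DQ F = fun p => a • AQ β G p) (h2 : DQ G = fun p => b • AQ β F p) (p) :
    Mop ε μ β (MstarOp ε μ β F) p = 0 := by
  set κ : ℂ := ((Real.sqrt (ε * μ) : ℝ) : ℂ) with hκ
  have hκ2 : κ * κ = ((ε * μ : ℝ) : ℂ) := by
    rw [hκ, ← Complex.ofReal_mul, Real.mul_self_sqrt (by positivity)]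
  have hM : ∀ K q, Mop ε μ β K q = κ • AQ β K q + (-Complex.I) • DQ K q := by
    intro K q
    simp only [Mop, AQ, Complex.ofReal_mul, ← hκ]
    ext <;> simp <;> ring
  have hMs : MstarOp ε μ β F = fun q => κ • AQ β F q + Complex.I • DQ F q := by
    funext q
    simp only [MstarOp, AQ, Complex.ofReal_mul, ← hκ]
    ext <;> simp <;> ring
  have hA : CQ 2 (AQ β F) := CQ.AQ hF
  have hD : CQ 3 (DQ F) := CQ.DQ hF
  have hD2 : CQ 2 (DQ F) := hD.mono (by omega)
  have hDD : DQ (DQ F) p = (a * b) • AQ β (AQ β F) p := by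
    conv_lhs => rw [h1]
    rw [DQ_smul ((CQ.AQ (n := 2) hG).mono (by omega)), DQ_AQ (hG.mono (by omega)), h2, AQ_smul hA]
    simp only [smul_smul]
  rw [hM, hMs, AQ_add (hA.smul _) (hD2.smul _), AQ_smul hA, AQ_smul hD2,
    DQ_add ((hA.smul _).mono (by omega)) ((hD2.smul _).mono (by omega)),
    DQ_smul (hA.mono (by omega)), DQ_smul (hD2.mono (by omega)), DQ_AQ (hF.mono (by omega))]
  beta_reduce
  rw [hDD, hab, ← hκ2]
  have hI := Complex.I_mul_I
  ext
  · change _ = (0 : ℂ)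
    simp
    linear_combination (κ * κ * (AQ β (AQ β F) p).re) * hI
  · change _ = (0 : ℂ)
    simp
    linear_combination (κ * κ * (AQ β (AQ β F) p).imI) * hI
  · change _ = (0 : ℂ)
    simp
    linear_combination (κ * κ * (AQ β (AQ β F) p).imJ) * hI
  · change _ = (0 : ℂ)
    simp
    linear_combination (κ * κ * (AQ β (AQ β F) p).imK) * hI

lemma CQ_vecR {n : ℕ} {E : ℝ × V3 → V3} (h : ContDiff ℝ n E) : CQ n (fun q => vecR (E q)) := by
  have hk : ∀ k, ContDiff ℝ n (fun q => ((E q k : ℝ) : ℂ)) := fun k =>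
    Complex.ofRealCLM.contDiff.comp (contDiff_pi.1 h k)
  exact ⟨contDiff_const, hk 0, hk 1, hk 2⟩

lemma diff_of_CQ {E : ℝ × V3 → V3} (h : CQ 1 (fun q => vecR (E q))) : Differentiable ℝ E := by
  obtain ⟨-, b, c, d⟩ := h.diff le_rfl
  rw [differentiable_pi]
  intro k
  fin_cases k
  · exact Complex.reCLM.differentiable.comp b
  · exact Complex.reCLM.differentiable.comp c
  · exact Complex.reCLM.differentiable.comp d

lemma pdC_ofReal {g : V3 → ℝ} (h : Differentiable ℝ g) (k x) :
    pdC k (fun y => (g y : ℂ)) x = (pdR k g x : ℂ) := by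
  have := (Complex.ofRealCLM.hasFDerivAt.comp x (h x).hasFDerivAt).fderiv
  unfold pdC pdR
  have h2 : (fun y => (g y : ℂ)) = Complex.ofRealCLM ∘ g := rfl
  rw [h2, this]; rfl

lemma ptQ_vecR {E : ℝ × V3 → V3} (h : Differentiable ℝ E) (p) :
    ptQ (fun q => vecR (E q)) p = vecR (ptV E p) := by
  have hs : Differentiable ℝ (fun s : ℝ => E (s, p.2)) := by fun_prop
  have hd := (hs p.1).hasDerivAt
  rw [hasDerivAt_pi] at hd
  have hk := fun k => (hd k).ofReal_comp.deriv
  ext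
  · simp [ptQ, vecR, vecC, bq]
  · exact hk 0
  · exact hk 1
  · exact hk 2

set_option linter.unusedSimpArgs false in
lemma DQ_vecR {E : ℝ × V3 → V3} (h : Differentiable ℝ E) (hdiv : ∀ p, div3 E p = 0) :
    DQ (fun q => vecR (E q)) = fun q => vecR (rot3 E q) := by
  funext p
  have hk : ∀ k, Differentiable ℝ (fun y => E (p.1, y) k) := by
    intro k
    have hs : Differentiable ℝ (fun y => E (p.1, y)) := by fun_prop
    exact differentiable_pi.1 hs k
  have h0 : ∀ k x, pdC k (fun _ => (0 : ℂ)) x = 0 := by intro k x; simp [pdC]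
  have hd := hdiv p
  simp only [div3, Fin.sum_univ_three] at hd
  have hd' := congrArg (fun r : ℝ => (r : ℂ)) hd
  simp only [Complex.ofReal_add, Complex.ofReal_zero] at hd'
  simp only [DQ, Dop]
  ext
  · simp only [Quaternion.re_add, qi0_re, qi0_imI, qi0_imJ, qi0_imK, qi1_re, qi1_imI, qi1_imJ, qi1_imK, qi2_re, qi2_imI, qi2_imJ, qi2_imK, pdQ_re, pdQ_imI, pdQ_imJ, pdQ_imK,
      vecR_re, vecR_imI, vecR_imJ, vecR_imK, h0, pdC_ofReal (hk _)]
    linear_combination -hd'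
  · simp only [Quaternion.imI_add, qi0_re, qi0_imI, qi0_imJ, qi0_imK, qi1_re, qi1_imI, qi1_imJ, qi1_imK, qi2_re, qi2_imI, qi2_imJ, qi2_imK, pdQ_re, pdQ_imI, pdQ_imJ, pdQ_imK,
      vecR_re, vecR_imI, vecR_imJ, vecR_imK, h0, pdC_ofReal (hk _)]
    simp [rot3]
    try ring
  · simp only [Quaternion.imJ_add, qi0_re, qi0_imI, qi0_imJ, qi0_imK, qi1_re, qi1_imI, qi1_imJ, qi1_imK, qi2_re, qi2_imI, qi2_imJ, qi2_imK, pdQ_re, pdQ_imI, pdQ_imJ, pdQ_imK,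
      vecR_re, vecR_imI, vecR_imJ, vecR_imK, h0, pdC_ofReal (hk _)]
    simp [rot3]
    try ring
  · simp only [Quaternion.imK_add, qi0_re, qi0_imI, qi0_imJ, qi0_imK, qi1_re, qi1_imI, qi1_imJ, qi1_imK, qi2_re, qi2_imI, qi2_imJ, qi2_imK, pdQ_re, pdQ_imI, pdQ_imJ, pdQ_imK,
      vecR_re, vecR_imI, vecR_imJ, vecR_imK, h0, pdC_ofReal (hk _)]
    simp [rot3]
    try ring

lemma AQ_vecR {β : ℝ} {E : ℝ × V3 → V3} (h : ContDiff ℝ 4 E) (hdiv : ∀ p, div3 E p = 0) (p) :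
    AQ β (fun q => vecR (E q)) p = vecR (ptV E p + β • ptV (rot3 E) p) := by
  have hd : Differentiable ℝ E := h.differentiable (by simp)
  have hC : CQ 4 (fun q => vecR (E q)) := CQ_vecR h
  have hr : CQ 3 (fun q => vecR (rot3 E q)) := by rw [← DQ_vecR hd hdiv]; exact CQ.DQ hC
  unfold AQ
  rw [DQ_vecR hd hdiv, ptQ_vecR hd, ptQ_vecR (diff_of_CQ (hr.mono (by omega)))]
  ext <;> simp [vecR_re, vecR_imI, vecR_imJ, vecR_imK]

lemma vecR_smul (c : ℝ) (v : V3) : vecR (c • v) = (c : ℂ) • vecR v := by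
  ext <;> simp [vecR_re, vecR_imI, vecR_imJ, vecR_imK]

/-- For a solution of the sourceless chiral Maxwell system, both `E`
and `H` (viewed as purely vectorial biquaternion-valued functions) satisfy
`M M* E = 0` and `M M* H = 0`. -/
theorem MMstar_annihilates_sourceless_solutions
    (ε μ β : ℝ) (hε : 0 < ε) (hμ : 0 < μ)
    (E H : ℝ × V3 → V3)
    (hE : ContDiff ℝ 4 E) (hH : ContDiff ℝ 4 H)
    (hMax1 : ∀ p : ℝ × V3, rot3 H p = ε • (ptV E p + β • ptV (rot3 E) p))
    (hMax2 : ∀ p : ℝ × V3, rot3 E p = -(μ • (ptV H p + β • ptV (rot3 H) p)))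
    (hMax3E : ∀ p : ℝ × V3, div3 E p = 0)
    (hMax3H : ∀ p : ℝ × V3, div3 H p = 0) :
    (∀ p : ℝ × V3, Mop ε μ β (MstarOp ε μ β (fun q => vecR (E q))) p = 0) ∧
    (∀ p : ℝ × V3, Mop ε μ β (MstarOp ε μ β (fun q => vecR (H q))) p = 0) := by
  have dE : Differentiable ℝ E := hE.differentiable (by simp)
  have dH : Differentiable ℝ H := hH.differentiable (by simp)
  have h1 : DQ (fun q => vecR (E q)) =
      fun p => ((-μ : ℝ) : ℂ) • AQ β (fun q => vecR (H q)) p := by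
    rw [DQ_vecR dE hMax3E]
    funext p
    rw [AQ_vecR hH hMax3H, hMax2, ← neg_smul, vecR_smul]
  have h2 : DQ (fun q => vecR (H q)) =
      fun p => (ε : ℂ) • AQ β (fun q => vecR (E q)) p := by
    rw [DQ_vecR dH hMax3H]
    funext p
    rw [AQ_vecR hE hMax3E, hMax1, vecR_smul]
  exact ⟨core ε μ β hε hμ _ _ (CQ_vecR hE) (CQ_vecR hH) _ _ (by push_cast; ring) h1 h2,
    core ε μ β hε hμ _ _ (CQ_vecR hH) (CQ_vecR hE) _ _ (by push_cast; ring) h2 h1⟩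
end
end

section
/- Let α ∈ ℂ with Im α ≥ 0, and let 𝒦_α(x) = (α + x/|x|² − iα x/|x|) Θ_α(x) with Θ_α(x) = −e^{iα|x|}/(4π|x|). Then 𝒦_α satisfies the radiation condition (1 + i x/|x|) · 𝒦_α(x) = o(1/|x|) as |x| → ∞, uniformly in all directions; that is, |x| · ‖(1 + i x/|x|) · 𝒦_α(x)‖ → 0 as |x| → ∞. -/
noncomputable section

/-- A norm on the biquaternions `ℍ[ℂ]`. -/
def qnorm (q : BQ) : ℝ :=
  ‖q.re‖ + ‖q.imI‖ + ‖q.imJ‖ + ‖q.imK‖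


lemma one_c0 : (1 : BQ).re = 1 := rfl
lemma one_c1 : (1 : BQ).imI = 0 := rfl
lemma one_c2 : (1 : BQ).imJ = 0 := rfl
lemma one_c3 : (1 : BQ).imK = 0 := rfl
lemma sv_c0 (x : V3) : (vecR x).re = 0 := rfl
lemma sv_c1 (x : V3) : (vecR x).imI = x 0 := rfl
lemma sv_c2 (x : V3) : (vecR x).imJ = x 1 := rfl
lemma sv_c3 (x : V3) : (vecR x).imK = x 2 := rfl

lemma Kfun_aux (α : ℂ) (x : V3) (hr : 0 < enorm3 x) :
    (1 + (Complex.I * ((enorm3 x : ℝ) : ℂ)⁻¹) • vecR x) * Kfun α x =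
    (⟨Theta α x * (-Complex.I * ((enorm3 x : ℝ) : ℂ)⁻¹),
      Theta α x * (x 0 * (((enorm3 x : ℝ) : ℂ)⁻¹) ^ 2),
      Theta α x * (x 1 * (((enorm3 x : ℝ) : ℂ)⁻¹) ^ 2),
      Theta α x * (x 2 * (((enorm3 x : ℝ) : ℂ)⁻¹) ^ 2)⟩ : BQ) := by
  have h1 : (enorm3 x) ^ 2 = x 0 ^ 2 + x 1 ^ 2 + x 2 ^ 2 := by
    unfold enorm3; rw [Real.sq_sqrt]; positivity
  have h2 : ((enorm3 x : ℝ) : ℂ) ^ 2 = (x 0 : ℂ) ^ 2 + (x 1 : ℂ) ^ 2 + (x 2 : ℂ) ^ 2 := by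
    exact_mod_cast h1
  have h0 : ((enorm3 x : ℝ) : ℂ) ≠ 0 := by exact_mod_cast hr.ne'
  have hI : Complex.I ^ 2 = -1 := Complex.I_sq
  unfold Kfun
  generalize Theta α x = t
  simp only [Complex.ofReal_inv, Complex.ofReal_pow]
  generalize ((enorm3 x : ℝ) : ℂ) = r at *
  obtain ⟨s, hs⟩ : ∃ s, s = r⁻¹ := ⟨_, rfl⟩
  have hrs : r * s = 1 := by rw [hs]; exact mul_inv_cancel₀ h0
  have h3 : s ^ 2 * ((x 0 : ℂ) ^ 2 + (x 1 : ℂ) ^ 2 + (x 2 : ℂ) ^ 2) = 1 := by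
    rw [← h2, ← mul_pow, mul_comm, hrs, one_pow]
  have hs2 : (r ^ 2)⁻¹ = s ^ 2 := by rw [hs, inv_pow]
  rw [hs2, ← hs]
  clear hs hs2 h2 h0 hrs
  ext <;> simp only [Quaternion.re_mul, Quaternion.imI_mul, Quaternion.imJ_mul,
    Quaternion.imK_mul, Quaternion.re_add, Quaternion.imI_add, Quaternion.imJ_add,
    Quaternion.imK_add, Quaternion.re_sub, Quaternion.imI_sub, Quaternion.imJ_sub,
    Quaternion.imK_sub, Quaternion.re_smul, Quaternion.imI_smul, Quaternion.imJ_smul,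
    Quaternion.imK_smul, Quaternion.re_coe, Quaternion.imI_coe, Quaternion.imJ_coe,
    Quaternion.imK_coe, one_c0, one_c1, one_c2, one_c3, sv_c0, sv_c1, sv_c2, sv_c3, smul_eq_mul]
  · linear_combination (-t * Complex.I * s + Complex.I ^ 2 * α * t) * h3 + α * t * hI
  all_goals ring

/-- For `Im α ≥ 0`, the fundamental solution `𝒦_α` satisfies the
radiation condition `(1 + i x/|x|) ⬝ 𝒦_α(x) = o(1/|x|)` as `|x| → ∞`, uniformly in
all directions. -/
theorem Kfun_radiation_condition (α : ℂ) (hα : 0 ≤ α.im) :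
    Filter.Tendsto
      (fun x : V3 => enorm3 x *
        qnorm ((1 + (Complex.I * ((enorm3 x : ℝ) : ℂ)⁻¹) • vecR x) * Kfun α x))
      (Filter.comap enorm3 Filter.atTop) (nhds 0) := by
  have key : ∀ x : V3, 1 ≤ enorm3 x → enorm3 x *
        qnorm ((1 + (Complex.I * ((enorm3 x : ℝ) : ℂ)⁻¹) • vecR x) * Kfun α x) ≤
        4 * (enorm3 x)⁻¹ := by
    intro x hx
    have hr : 0 < enorm3 x := by linarith
    rw [Kfun_aux α x hr]
    have h1 : (enorm3 x) ^ 2 = x 0 ^ 2 + x 1 ^ 2 + x 2 ^ 2 := by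
      unfold enorm3; rw [Real.sq_sqrt]; positivity
    have ht : ‖Theta α x‖ ≤ (enorm3 x)⁻¹ := by
      unfold Theta
      rw [norm_div, norm_neg, Complex.norm_exp]
      have he : Real.exp (Complex.I * α * (enorm3 x : ℝ)).re ≤ 1 := by
        rw [Real.exp_le_one_iff]
        simp
        positivity
      have hd : ‖(4 * Real.pi * (enorm3 x : ℝ) : ℂ)‖ = 4 * Real.pi * enorm3 x := by
        simp [abs_of_pos hr, abs_of_pos Real.pi_pos]
      rw [hd, inv_eq_one_div]
      have := Real.pi_gt_three
      apply div_le_div₀ zero_le_one he hr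
      nlinarith
    have hc : ∀ k, |x k| ≤ enorm3 x := by
      intro k
      refine abs_le_of_sq_le_sq ?_ hr.le
      rw [h1]
      fin_cases k <;> simp <;> nlinarith [sq_nonneg (x 0), sq_nonneg (x 1), sq_nonneg (x 2)]
    simp only [qnorm, norm_mul, norm_neg, Complex.norm_I, norm_inv, norm_pow, Complex.norm_real,
      Real.norm_eq_abs, abs_of_pos hr, one_mul]
    set r := enorm3 x
    set T := ‖Theta α x‖
    have hT : 0 ≤ T := norm_nonneg _
    have hk : ∀ k, |x k| * r⁻¹ ^ 2 ≤ r⁻¹ := by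
      intro k
      calc |x k| * r⁻¹ ^ 2 ≤ r * r⁻¹ ^ 2 := by gcongr; exact hc k
        _ = r⁻¹ := by field_simp
    calc _ ≤ r * (T * r⁻¹ + T * r⁻¹ + T * r⁻¹ + T * r⁻¹) := by
          gcongr
          exacts [hk 0, hk 1, hk 2]
      _ = 4 * T := by field_simp; ring
      _ ≤ _ := by gcongr
  have hev : ∀ᶠ x in Filter.comap enorm3 Filter.atTop, 1 ≤ enorm3 x :=
    Filter.tendsto_comap.eventually (Filter.eventually_ge_atTop 1)
  refine squeeze_zero' ?_ (hev.mono key) ?_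
  · filter_upwards [hev] with x hx
    unfold qnorm
    positivity
  · have := (tendsto_inv_atTop_zero (𝕜 := ℝ)).comp
      (Filter.tendsto_comap (f := enorm3) (x := Filter.atTop))
    simpa using this.const_mul 4
end
end

section
/- Let n ≥ 2 be an integer, let a ∈ ℂ with Im a > 0, and let t ∈ ℝ. Then the integral ∫_{−∞}^{∞} e^{iωt} / (ω − a)^n dω (which converges absolutely since n ≥ 2) equals 2πi (it)^{n−1} e^{iat} / (n−1)! if t ≥ 0, and equals 0 if t < 0. -/
open MeasureTheory

noncomputable section

lemma aux_norm (m : ℕ) (c : ℂ) (s : ℝ) (hs : 0 < s) :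
    ‖(s : ℂ) ^ m * Complex.exp (c * s)‖ = s ^ (m : ℝ) * Real.exp (-(-c.re) * s) := by
  rw [norm_mul, norm_pow, Complex.norm_exp, Complex.norm_real, Real.norm_of_nonneg hs.le,
    Real.rpow_natCast]
  simp

lemma aux_intble (m : ℕ) (c : ℂ) (hc : c.re < 0) :
    IntegrableOn (fun s : ℝ => (s : ℂ) ^ m * Complex.exp (c * s)) (Set.Ioi 0) := by
  have h := integrableOn_rpow_mul_exp_neg_mul_rpow (p := 1) (s := m) (b := -c.re)
    (by have : (0 : ℝ) ≤ m := Nat.cast_nonneg m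
        linarith) one_pos (by linarith)
  refine Integrable.mono' h (Continuous.aestronglyMeasurable (by fun_prop)) ?_
  filter_upwards [ae_restrict_mem measurableSet_Ioi] with s hs
  rw [aux_norm m c s hs, Real.rpow_one]

lemma aux_laplace (m : ℕ) (c : ℂ) (hc : c.re < 0) :
    ∫ s : ℝ in Set.Ioi 0, (s : ℂ) ^ m * Complex.exp (c * s)
      = (Nat.factorial m : ℂ) / (-c) ^ (m + 1) := by
  have hc0 : c ≠ 0 := by rintro rfl; simp at hc
  induction m with
  | zero =>
    simp only [pow_zero, one_mul]
    rw [integral_exp_mul_complex_Ioi hc]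
    simp
    field_simp
  | succ m ih =>
    have hd : ∀ s ∈ Set.Ici (0:ℝ), HasDerivAt
        (fun s : ℝ => (s : ℂ) ^ (m + 1) * Complex.exp (c * s))
        ((m + 1 : ℂ) * ((s : ℂ) ^ m * Complex.exp (c * s))
          + c * ((s : ℂ) ^ (m + 1) * Complex.exp (c * s))) s := by
      intro s _
      have h1 : HasDerivAt (fun z : ℂ => z ^ (m + 1) * Complex.exp (c * z))
        ((m + 1 : ℂ) * ((s : ℂ) ^ m * Complex.exp (c * s))
          + c * ((s : ℂ) ^ (m + 1) * Complex.exp (c * s))) (s : ℂ) := by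
        have := (hasDerivAt_pow (m + 1) (s : ℂ)).mul (((hasDerivAt_id (s : ℂ)).const_mul c).cexp)
        convert! this using 1
        simp
        ring
      exact h1.comp_ofReal
    have hi1 := (aux_intble m c hc).const_mul (m + 1 : ℂ)
    have hi2 := (aux_intble (m + 1) c hc).const_mul c
    have ht : Filter.Tendsto (fun s : ℝ => (s : ℂ) ^ (m + 1) * Complex.exp (c * s))
        Filter.atTop (nhds 0) := by
      rw [tendsto_zero_iff_norm_tendsto_zero]
      refine (tendsto_rpow_mul_exp_neg_mul_atTop_nhds_zero ((m + 1 : ℕ) : ℝ) (-c.re)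
        (by linarith)).congr' ?_
      filter_upwards [Filter.eventually_gt_atTop 0] with s hs
      rw [aux_norm _ c s hs]
    have key := integral_Ioi_of_hasDerivAt_of_tendsto' hd (hi1.add hi2) ht
    rw [integral_add hi1 hi2, integral_const_mul, integral_const_mul, ih] at key
    simp only [Complex.ofReal_zero, ne_eq, Nat.add_eq_zero_iff, one_ne_zero, and_false,
      not_false_eq_true, zero_pow, zero_mul, sub_zero] at key
    have h2 : c * (∫ s : ℝ in Set.Ioi 0, (s : ℂ) ^ (m + 1) * Complex.exp (c * s))
       = -((m + 1 : ℂ) * ((Nat.factorial m : ℂ) / (-c) ^ (m + 1))) := by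
      linear_combination key
    apply mul_left_cancel₀ hc0
    rw [h2, Nat.factorial_succ, pow_succ (-c) (m + 1)]
    have : (-c) ^ (m + 1) ≠ 0 := pow_ne_zero _ (neg_ne_zero.2 hc0)
    push_cast
    field_simp

lemma aux_ne (a : ℂ) (ha : 0 < a.im) (ω : ℝ) : (ω : ℂ) - a ≠ 0 := by
  intro h
  have := congrArg Complex.im h
  simp at this
  linarith

lemma aux_integrable (n : ℕ) (hn : 2 ≤ n) (a : ℂ) (ha : 0 < a.im) (t : ℝ) :
    Integrable (fun ω : ℝ =>
        Complex.exp (Complex.I * (ω : ℂ) * (t : ℂ)) / ((ω : ℂ) - a) ^ n) := by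
  have h0 : Integrable (fun ω : ℝ => (a.im ^ n)⁻¹ * (1 + ((ω - a.re) / a.im) ^ 2)⁻¹) :=
    (((integrable_inv_one_add_sq.comp_div ha.ne').comp_sub_right a.re)).const_mul _
  refine Integrable.mono' h0 (Continuous.aestronglyMeasurable ?_) (ae_of_all _ fun ω => ?_)
  · exact Continuous.div (by fun_prop) (by fun_prop) (fun ω => pow_ne_zero _ (aux_ne a ha ω))
  · have h1 : ‖Complex.exp (Complex.I * (ω : ℂ) * (t : ℂ))‖ = 1 := by
      rw [Complex.norm_exp]; simp
    have hsq : ‖(ω : ℂ) - a‖ ^ 2 = a.im ^ 2 * (1 + ((ω - a.re) / a.im) ^ 2) := by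
      rw [Complex.sq_norm, Complex.normSq_apply]
      simp
      field_simp
      ring
    have hge : a.im ≤ ‖(ω : ℂ) - a‖ := by
      have := Complex.abs_im_le_norm ((ω : ℂ) - a)
      simp [abs_of_pos ha] at this
      exact this
    rw [norm_div, h1, norm_pow, one_div, ← mul_inv]
    obtain ⟨k, rfl⟩ := Nat.exists_eq_add_of_le hn
    apply inv_anti₀ (by positivity)
    rw [pow_add, pow_add, hsq]
    have := pow_le_pow_left₀ ha.le hge k
    calc _ = a.im ^ 2 * (1 + ((ω - a.re) / a.im) ^ 2) * a.im ^ k := by ring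
      _ ≤ _ := by gcongr

lemma aux_main (m : ℕ) (hm : 1 ≤ m) (a : ℂ) (ha : 0 < a.im) (t : ℝ) :
    ∫ ω : ℝ, Complex.exp (Complex.I * (ω : ℂ) * (t : ℂ)) / ((ω : ℂ) - a) ^ (m + 1) =
      2 * (Real.pi : ℂ) * Complex.I ^ (m + 1) / (Nat.factorial m : ℂ)
        * (((max t 0 : ℝ) : ℂ) ^ m * Complex.exp (Complex.I * a * t)) := by
  set f : ℝ → ℂ := fun s => ((max s 0 : ℝ) : ℂ) ^ m * Complex.exp (Complex.I * a * s) with hf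
  have hfc : Continuous f := by
    have : Continuous fun s : ℝ => max s 0 := by fun_prop
    exact ((Complex.continuous_ofReal.comp this).pow m).mul (by fun_prop)
  have hind : ∀ w : ℝ, (fun s : ℝ => Complex.exp (↑(-2 * Real.pi * s * w) * Complex.I) • f s)
      = Set.indicator (Set.Ioi 0) (fun s : ℝ => (s : ℂ) ^ m *
        Complex.exp ((Complex.I * a - 2 * Real.pi * w * Complex.I) * s)) := by
    intro w
    ext s
    by_cases hs : 0 < s
    · rw [Set.indicator_of_mem (by exact hs)]
      simp only [hf, smul_eq_mul, max_eq_left hs.le]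
      rw [mul_left_comm, ← Complex.exp_add]
      congr 2
      push_cast
      ring
    · rw [Set.indicator_of_notMem (by exact hs)]
      simp only [hf, smul_eq_mul, max_eq_right (not_lt.1 hs)]
      simp [Nat.one_le_iff_ne_zero.1 hm]
  have hre : ∀ w : ℝ, (Complex.I * a - 2 * Real.pi * w * Complex.I).re < 0 := by
    intro w
    simp [ha]
  have hfi : Integrable f := by
    have h := hind 0
    simp only [mul_zero, Complex.ofReal_zero, zero_mul, Complex.exp_zero, one_smul] at h
    have h' : f = _ := h
    rw [h', integrable_indicator_iff measurableSet_Ioi]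
    exact aux_intble m _ (by simpa using hre 0)
  have hF : FourierTransform.fourier f = fun w : ℝ =>
      (Nat.factorial m : ℂ) / Complex.I ^ (m + 1) *
        (1 / (((2 * Real.pi * w : ℝ) : ℂ) - a) ^ (m + 1)) := by
    ext w
    rw [Real.fourier_real_eq_integral_exp_smul, hind w, integral_indicator measurableSet_Ioi,
      aux_laplace m _ (hre w)]
    have : -(Complex.I * a - 2 * Real.pi * w * Complex.I)
      = Complex.I * (((2 * Real.pi * w : ℝ) : ℂ) - a) := by push_cast; ring
    rw [this, mul_pow, div_mul_div_comm, mul_one]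
  have hpi : (2 * Real.pi) ≠ 0 := by positivity
  have hFi : Integrable (FourierTransform.fourier f) := by
    rw [hF]
    have h := aux_integrable (m + 1) (by omega) a ha 0
    simp only [Complex.ofReal_zero, mul_zero, Complex.exp_zero] at h
    exact (h.comp_mul_left' hpi).const_mul _
  have hinv := congrFun (hfc.fourierInv_fourier_eq hfi hFi) t
  rw [Real.fourierInv_eq', hF] at hinv
  have hcv := Measure.integral_comp_mul_left (fun ω : ℝ =>
    Complex.exp (Complex.I * (ω : ℂ) * (t : ℂ)) / ((ω : ℂ) - a) ^ (m + 1)) (2 * Real.pi)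
  have e : ∀ w : ℝ, Complex.exp (↑(2 * Real.pi * inner ℝ w t) * Complex.I) •
      ((Nat.factorial m : ℂ) / Complex.I ^ (m + 1) *
        (1 / (((2 * Real.pi * w : ℝ) : ℂ) - a) ^ (m + 1)))
      = (Nat.factorial m : ℂ) / Complex.I ^ (m + 1) *
        (Complex.exp (Complex.I * ((2 * Real.pi * w : ℝ) : ℂ) * (t : ℂ)) /
          (((2 * Real.pi * w : ℝ) : ℂ) - a) ^ (m + 1)) := by
    intro w
    have : (↑(2 * Real.pi * inner ℝ w t) * Complex.I : ℂ)
      = Complex.I * ((2 * Real.pi * w : ℝ) : ℂ) * (t : ℂ) := by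
      simp
      ring
    rw [this, smul_eq_mul]
    ring
  simp only [e] at hinv
  rw [integral_const_mul, hcv, abs_of_pos (by positivity), Complex.real_smul] at hinv
  change _ = _ * f t
  rw [← hinv]
  have h1 : (Nat.factorial m : ℂ) ≠ 0 := by exact_mod_cast Nat.factorial_ne_zero m
  have h2 : (Real.pi : ℂ) ≠ 0 := by exact_mod_cast Real.pi_ne_zero
  have h3 : Complex.I ^ (m + 1) ≠ 0 := pow_ne_zero _ Complex.I_ne_zero
  generalize (∫ ω : ℝ, Complex.exp (Complex.I * (ω : ℂ) * (t : ℂ)) / ((ω : ℂ) - a) ^ (m + 1)) = J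
  push_cast
  field_simp

/-- For `n ≥ 2`, `Im a > 0` and `t ∈ ℝ`, the absolutely convergent
integral `∫ e^{iωt}/(ω−a)^n dω` equals `2πi (it)^{n−1} e^{iat}/(n−1)!` for `t ≥ 0`
and `0` for `t < 0`. -/
theorem integral_exp_div_pow_shifted
    (n : ℕ) (hn : 2 ≤ n) (a : ℂ) (ha : 0 < a.im) (t : ℝ) :
    Integrable (fun ω : ℝ =>
        Complex.exp (Complex.I * (ω : ℂ) * (t : ℂ)) / ((ω : ℂ) - a) ^ n) ∧
    (0 ≤ t →
      ∫ ω : ℝ, Complex.exp (Complex.I * (ω : ℂ) * (t : ℂ)) / ((ω : ℂ) - a) ^ n =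
        2 * (Real.pi : ℂ) * Complex.I * (Complex.I * (t : ℂ)) ^ (n - 1)
          * Complex.exp (Complex.I * a * (t : ℂ)) / (Nat.factorial (n - 1) : ℂ)) ∧
    (t < 0 →
      ∫ ω : ℝ, Complex.exp (Complex.I * (ω : ℂ) * (t : ℂ)) / ((ω : ℂ) - a) ^ n = 0) := by
  obtain ⟨m, rfl⟩ : ∃ m, n = m + 1 := ⟨n - 1, by omega⟩
  refine ⟨aux_integrable _ hn a ha t, fun ht => ?_, fun ht => ?_⟩
  · rw [aux_main m (by omega) a ha t, max_eq_left ht, Nat.add_sub_cancel]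
    ring
  · rw [aux_main m (by omega) a ha t, max_eq_right ht.le]
    simp [show m ≠ 0 by omega]
end
end

section
/- Let a ∈ ℂ with Im a > 0, let c ≥ 0 be real, and let t ∈ ℝ with t ≠ 0. Then the symmetric improper integral lim_{R→∞} (1/2π) ∫_{−R}^{R} e^{ic/(ω−a)} e^{iωt} / (ω − a) dω exists and equals i e^{iat} Σ_{j=0}^{∞} (−ct)^j / (j!)² if t > 0, and equals 0 if t < 0. -/
open MeasureTheory Filter

noncomputable section

lemma sia_ne (a : ℂ) (ha : 0 < a.im) (x : ℝ) : (x : ℂ) - a ≠ 0 := by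
  intro h
  have := congrArg Complex.im h
  simp at this
  linarith

lemma sia_norm_ge (a : ℂ) (x : ℝ) : a.im ≤ ‖(x : ℂ) - a‖ := by
  have := Complex.abs_im_le_norm ((x : ℂ) - a)
  simp at this
  exact (le_abs_self _).trans this

lemma sia_cont (a : ℂ) (ha : 0 < a.im) (t : ℝ) (n : ℕ) : Continuous
    (fun x : ℝ => Complex.exp (Complex.I * x * t) / ((x : ℂ) - a) ^ n) := by
  refine Continuous.div (by fun_prop) (by fun_prop) fun x => pow_ne_zero _ (sia_ne a ha x)

lemma sia_norm_exp (t x : ℝ) : ‖Complex.exp (Complex.I * x * t)‖ = 1 := by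
  rw [Complex.norm_exp]; simp

lemma sia_integrable (a : ℂ) (ha : 0 < a.im) : Integrable (fun x : ℝ => 1 / ‖(x : ℂ) - a‖ ^ 2) := by
  have h := ((integrable_inv_one_add_sq).comp_sub_right a.re).const_mul (1 + 1 / a.im ^ 2)
  refine h.mono' ?_ (ae_of_all _ fun x => ?_)
  · refine Continuous.aestronglyMeasurable ?_
    refine Continuous.div (by fun_prop) (by fun_prop) fun x => pow_ne_zero _
      (norm_ne_zero_iff.2 (sia_ne a ha x))
  · rw [Complex.sq_norm, Complex.normSq_apply, Real.norm_of_nonneg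
      (by have := mul_self_nonneg ((x : ℂ) - a).re; have := mul_self_nonneg ((x : ℂ) - a).im; positivity)]
    simp only [Complex.sub_re, Complex.ofReal_re, Complex.sub_im, Complex.ofReal_im]
    rw [← div_eq_mul_inv, div_le_div_iff₀ (by nlinarith [mul_self_nonneg (x - a.re), mul_pos ha ha]) (by positivity)]
    have : (1 + 1 / a.im ^ 2) * ((x - a.re) * (x - a.re) + (0 - a.im) * (0 - a.im)) =
      1 + (x - a.re)^2 + a.im^2 + (x-a.re)^2 / a.im^2 := by field_simp; ring
    rw [this]
    have : 0 ≤ a.im^2 + (x-a.re)^2 / a.im^2 := by positivity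
    linarith

lemma sia_laplace_int (r : ℂ) (hr : 0 < r.re) :
    IntegrableOn (fun s : ℝ => (s : ℂ) * Complex.exp (-r * s)) (Set.Ioi 0) := by
  have h := integrableOn_rpow_mul_exp_neg_mul_rpow (p := 1) (s := 1) (by norm_num) (by norm_num) hr
  refine Integrable.mono' h (Continuous.aestronglyMeasurable (by fun_prop)) ?_
  refine (ae_restrict_iff' measurableSet_Ioi).2 (ae_of_all _ fun x hx => ?_)
  simp only [Set.mem_Ioi] at hx
  simp [Complex.norm_exp, abs_of_pos hx]

lemma sia_laplace (r : ℂ) (hr : 0 < r.re) :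
    ∫ s in Set.Ioi (0 : ℝ), (s : ℂ) * Complex.exp (-r * s) = 1 / r ^ 2 := by
  have hr0 : r ≠ 0 := by rintro rfl; simp at hr
  have hd : ∀ x : ℝ, HasDerivAt (fun s : ℝ => -((s : ℂ) / r + 1 / r ^ 2) * Complex.exp (-r * s))
      ((x : ℂ) * Complex.exp (-r * x)) x := by
    intro x
    have h1 : HasDerivAt (fun s : ℂ => -(s / r + 1 / r ^ 2) * Complex.exp (-r * s))
      (-(1 / r) * Complex.exp (-r * x) + -((x : ℂ) / r + 1 / r ^ 2) * (Complex.exp (-r * x) * (-r * 1))) (x : ℂ) :=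
      (((hasDerivAt_id (x : ℂ)).div_const r).add_const (1 / r ^ 2)).fun_neg.mul
        (((hasDerivAt_id (x : ℂ)).const_mul (-r)).cexp)
    convert h1.comp_ofReal using 1
    field_simp
    ring
  have ht : Tendsto (fun s : ℝ => -((s : ℂ) / r + 1 / r ^ 2) * Complex.exp (-r * s)) atTop (nhds 0) := by
    have e1 := tendsto_rpow_mul_exp_neg_mul_atTop_nhds_zero 1 _ hr
    have e0 := tendsto_rpow_mul_exp_neg_mul_atTop_nhds_zero 0 _ hr
    have := (e1.mul_const (1 / ‖r‖)).add (e0.mul_const (1 / ‖r‖ ^ 2))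
    simp only [zero_mul, add_zero] at this
    refine squeeze_zero_norm' ?_ this
    filter_upwards [eventually_gt_atTop 0] with s hs
    rw [norm_mul, norm_neg, Complex.norm_exp]
    have : ‖(s : ℂ) / r + 1 / r ^ 2‖ ≤ s / ‖r‖ + 1 / ‖r‖ ^ 2 := by
      refine (norm_add_le _ _).trans (by simp [abs_of_pos hs])
    refine (mul_le_mul_of_nonneg_right this (Real.exp_pos _).le).trans (le_of_eq ?_)
    simp
    ring
  have := integral_Ioi_of_hasDerivAt_of_tendsto (hd 0).continuousAt.continuousWithinAt (fun x _ => hd x)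
    (sia_laplace_int r hr) ht
  rw [this]; simp

open FourierTransform in
lemma sia_inv (a : ℂ) (ha : 0 < a.im) (t : ℝ) :
    ∫ x : ℝ, Complex.exp (Complex.I * x * t) / ((x : ℂ) - a) ^ 2 =
      -(2 * Real.pi) * (max t 0 : ℝ) * Complex.exp (Complex.I * a * t) := by
  set g : ℝ → ℂ := fun s => ((max s 0 : ℝ) : ℂ) * Complex.exp (Complex.I * a * s) with hg
  have hgc : Continuous g := by fun_prop
  have hgind : ∀ F : ℝ → ℂ, (fun s => F s * g s) = Set.indicator (Set.Ioi 0)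
      (fun s => F s * ((s : ℂ) * Complex.exp (Complex.I * a * s))) := by
    intro F; ext s
    by_cases hs : 0 < s
    · simp [hg, hs, hs.le]
    · simp [hg, hs, not_lt.1 hs]
  have hgi : Integrable g := by
    have := hgind 1
    simp only [Pi.one_apply, one_mul] at this
    change g = _ at this
    rw [this, integrable_indicator_iff measurableSet_Ioi]
    have := sia_laplace_int (-(Complex.I * a)) (by simpa using ha)
    simpa using this
  have hF : 𝓕 g = fun ξ : ℝ => -1 / (((2 * Real.pi * ξ : ℝ) : ℂ) - a) ^ 2 := by
    ext ξ
    rw [Real.fourier_real_eq_integral_exp_smul]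
    simp only [smul_eq_mul]
    rw [hgind, integral_indicator measurableSet_Ioi]
    have := sia_laplace (Complex.I * (((2 * Real.pi * ξ : ℝ) : ℂ) - a)) (by simpa using ha)
    have e : (-1 / (((2 * Real.pi * ξ : ℝ) : ℂ) - a) ^ 2) =
       1 / (Complex.I * (((2 * Real.pi * ξ : ℝ) : ℂ) - a)) ^ 2 := by
      rw [mul_pow, Complex.I_sq, neg_one_mul, div_neg, neg_div]
    rw [e, ← this]
    congr 1; ext s
    rw [mul_left_comm, ← Complex.exp_add]
    congr 2
    push_cast; ring
  have hFi : Integrable (𝓕 g) := by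
    rw [hF]
    have h := (sia_integrable a ha).comp_mul_left' (R := 2 * Real.pi) (by positivity)
    refine h.mono' ?_ (ae_of_all _ fun x => ?_)
    · refine Continuous.aestronglyMeasurable ?_
      refine Continuous.div (by fun_prop) (by fun_prop) fun x => pow_ne_zero _ (sia_ne a ha _)
    · simp
  have key := congrFun (hgc.fourierInv_fourier_eq hgi hFi) t
  rw [Real.fourierInv_eq', hF] at key
  have hs := Measure.integral_comp_mul_left
    (fun x : ℝ => Complex.exp (Complex.I * x * t) / ((x : ℂ) - a) ^ 2) (2 * Real.pi)
  have e : ∫ x : ℝ, Complex.exp (Complex.I * (2 * Real.pi * x : ℝ) * t) / (((2 * Real.pi * x : ℝ) : ℂ) - a) ^ 2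
      = - g t := by
    rw [← key, ← integral_neg]
    congr 1; ext v
    simp only [smul_eq_mul, neg_div, mul_neg, neg_neg, mul_one_div]
    congr 2
    simp
    ring
  rw [e] at hs
  have hp : (0:ℝ) < 2 * Real.pi := by positivity
  rw [abs_of_pos (by positivity), eq_inv_smul_iff₀ hp.ne'] at hs
  rw [← hs, hg]
  simp
  ring

lemma sia_bdry (a : ℂ) (ha : 0 < a.im) (t : ℝ) (n : ℕ) (σ : ℝ) (hσ : |σ| = 1) :
    Tendsto (fun R : ℝ => Complex.exp (Complex.I * (σ * R : ℝ) * t) / (((σ * R : ℝ) : ℂ) - a) ^ (n + 1))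
      atTop (nhds 0) := by
  have h1 : Tendsto (fun R : ℝ => R - ‖a‖) atTop atTop := tendsto_atTop_add_const_right _ _ tendsto_id
  have h2 := ((tendsto_pow_atTop (n := n + 1) (by simp)).comp h1).inv_tendsto_atTop
  refine squeeze_zero_norm' ?_ h2
  filter_upwards [eventually_gt_atTop ‖a‖] with R hR
  rw [norm_div, sia_norm_exp, norm_pow, one_div]
  simp only [Pi.inv_apply, Function.comp]
  have hn : R - ‖a‖ ≤ ‖((σ * R : ℝ) : ℂ) - a‖ := by
    have := norm_sub_norm_le ((σ * R : ℝ) : ℂ) a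
    have h0 : 0 < R := (norm_nonneg a).trans_lt hR
    rw [Complex.norm_real, Real.norm_eq_abs, abs_mul, hσ, one_mul, abs_of_pos h0] at this
    exact this
  have : 0 < R - ‖a‖ := by linarith
  gcongr

lemma sia_parts (a : ℂ) (ha : 0 < a.im) (t : ℝ) (n : ℕ) (R : ℝ) :
    ((n : ℂ) + 1) * ∫ x in (-R)..R, Complex.exp (Complex.I * x * t) / ((x : ℂ) - a) ^ (n + 2) =
    Complex.I * t * (∫ x in (-R)..R, Complex.exp (Complex.I * x * t) / ((x : ℂ) - a) ^ (n + 1)) -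
      (Complex.exp (Complex.I * (1 * R : ℝ) * t) / (((1 * R : ℝ) : ℂ) - a) ^ (n + 1) -
      Complex.exp (Complex.I * (-1 * R : ℝ) * t) / (((-1 * R : ℝ) : ℂ) - a) ^ (n + 1)) := by
  have hd : ∀ x : ℝ, HasDerivAt (fun x : ℝ => Complex.exp (Complex.I * x * t) / ((x : ℂ) - a) ^ (n + 1))
      (Complex.I * t * (Complex.exp (Complex.I * x * t) / ((x : ℂ) - a) ^ (n + 1)) -
        ((n : ℂ) + 1) * (Complex.exp (Complex.I * x * t) / ((x : ℂ) - a) ^ (n + 2))) x := by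
    intro x
    have hx := sia_ne a ha x
    have h1 := ((((hasDerivAt_id (x : ℂ)).const_mul Complex.I).mul_const (t : ℂ)).cexp).div
      (((hasDerivAt_id (x : ℂ)).sub_const a).pow (n + 1)) (pow_ne_zero _ hx)
    have h2 := h1.comp_ofReal
    refine HasDerivAt.congr_deriv (f := fun x : ℝ => Complex.exp (Complex.I * x * t) / ((x : ℂ) - a) ^ (n + 1)) h2 ?_
    simp only [id, Nat.add_sub_cancel]
    push_cast
    simp only [Pi.pow_apply, id]
    field_simp
    ring
  have hi : ∀ m, IntervalIntegrable (fun x : ℝ => Complex.exp (Complex.I * x * t) / ((x : ℂ) - a) ^ m)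
    volume (-R) R := fun m => (sia_cont a ha t m).intervalIntegrable _ _
  have := intervalIntegral.integral_eq_sub_of_hasDerivAt (a := -R) (b := R) (fun x _ => hd x)
    (((hi _).const_mul _).sub ((hi _).const_mul _))
  rw [intervalIntegral.integral_sub ((hi _).const_mul _) ((hi _).const_mul _),
    intervalIntegral.integral_const_mul, intervalIntegral.integral_const_mul] at this
  simp only [one_mul, neg_one_mul]
  rw [← this]
  ring

lemma sia_lim (a : ℂ) (ha : 0 < a.im) (t : ℝ) (ht : t ≠ 0) (V : ℂ)
    (hV : V * (Complex.I * t) = -(2 * Real.pi) * (max t 0 : ℝ) * Complex.exp (Complex.I * a * t)) (n : ℕ) :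
    Tendsto (fun R : ℝ => ∫ x in (-R)..R, Complex.exp (Complex.I * x * t) / ((x : ℂ) - a) ^ (n + 1))
      atTop (nhds (V * (Complex.I * t) ^ n / (n.factorial : ℂ))) := by
  have hb : ∀ n, Tendsto (fun R : ℝ => Complex.exp (Complex.I * (1 * R : ℝ) * t) / (((1 * R : ℝ) : ℂ) - a) ^ (n + 1) -
      Complex.exp (Complex.I * (-1 * R : ℝ) * t) / (((-1 * R : ℝ) : ℂ) - a) ^ (n + 1)) atTop (nhds 0) := by
    intro n
    simpa using (sia_bdry a ha t n 1 (by simp)).sub (sia_bdry a ha t n (-1) (by simp))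
  have hIt : Complex.I * t ≠ 0 := by simpa using ht
  induction n with
  | zero =>
    have hint : Integrable (fun x : ℝ => Complex.exp (Complex.I * x * t) / ((x : ℂ) - a) ^ 2) := by
      refine (sia_integrable a ha).mono' (sia_cont a ha t 2).aestronglyMeasurable
        (ae_of_all _ fun x => ?_)
      rw [norm_div, sia_norm_exp, norm_pow]
    have h1 := intervalIntegral_tendsto_integral hint tendsto_neg_atTop_atBot tendsto_id
    rw [sia_inv a ha t, ← hV] at h1
    have h2 := (h1.add (hb 0)).mul_const (Complex.I * t)⁻¹
    refine Tendsto.congr (fun R => ?_) (h2.trans (le_of_eq ?_))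
    · have := sia_parts a ha t 0 R
      simp only [Nat.cast_zero, zero_add, one_mul, id] at this ⊢
      rw [this, sub_add_cancel, mul_comm (Complex.I * (t : ℂ)), mul_inv_cancel_right₀ hIt]
    · congr 1
      rw [add_zero, mul_inv_cancel_right₀ hIt]
      simp
  | succ n ih =>
    have hn : (n : ℂ) + 1 ≠ 0 := Nat.cast_add_one_ne_zero n
    have h2 := ((ih.const_mul (Complex.I * t)).sub (hb n)).const_mul ((n : ℂ) + 1)⁻¹
    refine Tendsto.congr (fun R => ?_) (h2.trans (le_of_eq ?_))
    · rw [← sia_parts a ha t n R, inv_mul_cancel_left₀ hn]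
    · congr 1
      rw [Nat.factorial_succ]
      push_cast
      field_simp
      ring

lemma sia_main (a : ℂ) (ha : 0 < a.im) (c : ℝ) (t : ℝ) (ht : t ≠ 0) (V : ℂ)
    (hV : V * (Complex.I * t) = -(2 * Real.pi) * (max t 0 : ℝ) * Complex.exp (Complex.I * a * t)) :
    Tendsto (fun R : ℝ => ∫ ω in (-R)..R,
            Complex.exp (Complex.I * (c : ℂ) / ((ω : ℂ) - a))
              * Complex.exp (Complex.I * (ω : ℂ) * (t : ℂ)) / ((ω : ℂ) - a))
        atTop (nhds (V * ∑' j : ℕ, ((-(c * t) : ℝ) : ℂ) ^ j / ((Nat.factorial j : ℂ)) ^ 2)) := by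
  set M : ℝ := 1 / a.im with hM
  have hMpos : 0 < M := by positivity
  have hinv : ∀ x : ℝ, 1 / ‖(x : ℂ) - a‖ ≤ M := fun x =>
    one_div_le_one_div_of_le ha (sia_norm_ge a x)
  set F : ℕ → ℝ → ℂ := fun j x => (Complex.I * c) ^ j / (j.factorial : ℂ) *
    (Complex.exp (Complex.I * x * t) / ((x : ℂ) - a) ^ (j + 1)) with hF
  have hsum : ∀ k : ℝ, Summable (fun j : ℕ => |c| ^ j / (j.factorial : ℝ) * (M ^ j * k)) := by
    intro k
    have := (Real.summable_pow_div_factorial (|c| * M)).mul_right k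
    refine this.congr fun j => ?_
    rw [mul_pow]; ring
  have hcoef : ∀ j : ℕ, ‖(Complex.I * c) ^ j / (j.factorial : ℂ)‖ = |c| ^ j / (j.factorial : ℝ) := by
    intro j; simp
  have hseries : ∀ R : ℝ, HasSum (fun j => ∫ x in (-R)..R, F j x) (∫ ω in (-R)..R,
            Complex.exp (Complex.I * (c : ℂ) / ((ω : ℂ) - a))
              * Complex.exp (Complex.I * (ω : ℂ) * (t : ℂ)) / ((ω : ℂ) - a)) := by
    intro R
    refine intervalIntegral.hasSum_integral_of_dominated_convergence
      (fun j _ => |c| ^ j / (j.factorial : ℝ) * (M ^ j * M)) (fun j => ?_) (fun j => ?_) ?_ ?_ ?_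
    · exact ((sia_cont a ha t (j+1)).const_mul _).aestronglyMeasurable
    · refine ae_of_all _ fun x _ => ?_
      rw [hF, norm_mul, hcoef, norm_div, sia_norm_exp, norm_pow, ← pow_succ, ← one_div_pow]
      have := hinv x
      gcongr
    · exact ae_of_all _ fun x _ => hsum M
    · exact intervalIntegrable_const
    · refine ae_of_all _ fun x _ => ?_
      have h := (NormedSpace.expSeries_div_hasSum_exp (Complex.I * c / ((x : ℂ) - a)))
      rw [← Complex.exp_eq_exp_ℂ] at h
      have h2 := h.mul_right (Complex.exp (Complex.I * (x : ℂ) * (t : ℂ)) / ((x : ℂ) - a))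
      rw [← mul_div_assoc] at h2
      refine h2.congr_fun fun j => ?_
      have hx := sia_ne a ha x
      rw [hF]
      simp only [div_pow]
      rw [pow_succ]
      field_simp
  have hFlim : ∀ j, Tendsto (fun R : ℝ => ∫ x in (-R)..R, F j x) atTop
      (nhds ((Complex.I * c) ^ j / (j.factorial : ℂ) * (V * (Complex.I * t) ^ j / (j.factorial : ℂ)))) := by
    intro j
    simp only [hF, intervalIntegral.integral_const_mul]
    exact (sia_lim a ha t ht V hV j).const_mul _
  set K : ℝ := ∫ x : ℝ, 1 / ‖(x : ℂ) - a‖ ^ 2 with hK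
  have hK0 : 0 ≤ K := integral_nonneg fun x => by positivity
  have htan := tendsto_tsum_of_dominated_convergence (𝓕 := atTop)
    (f := fun (R : ℝ) j => ∫ x in (-R)..R, F j x) (hsum (‖V‖ + 1 + K / M)) hFlim ?_
  · have e : (fun R : ℝ => ∑' j, ∫ x in (-R)..R, F j x) = fun R => _ := funext fun R => (hseries R).tsum_eq
    rw [e] at htan
    convert htan using 2
    rw [← tsum_mul_left]
    congr 1; ext j
    have : ((-(c * t) : ℝ) : ℂ) = (Complex.I * c) * (Complex.I * t) := by
      push_cast
      linear_combination (-(c * t : ℂ)) * Complex.I_sq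
    rw [this, mul_pow]
    ring
  · have h0 : ∀ᶠ R : ℝ in atTop, ‖∫ x in (-R)..R, F 0 x‖ < ‖V‖ + 1 := by
      have := (hFlim 0).norm
      simp only [pow_zero, Nat.factorial_zero, Nat.cast_one, div_one, one_mul, mul_one] at this
      exact this.eventually_lt_const (by linarith)
    filter_upwards [h0, eventually_ge_atTop 0] with R hR hR0 j
    rcases j with _ | j
    · simp only [pow_zero, Nat.factorial_zero, Nat.cast_one, div_one, one_mul]
      have : 0 ≤ K / M := by positivity
      linarith
    · have hle : ‖∫ x in (-R)..R, Complex.exp (Complex.I * x * t) / ((x : ℂ) - a) ^ (j + 2)‖ ≤ M ^ j * K := by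
        have hii := (sia_integrable a ha).const_mul (M ^ j)
        refine (intervalIntegral.norm_integral_le_of_norm_le (by linarith)
          (ae_of_all _ fun x _ => ?_) hii.intervalIntegrable).trans ?_
        · rw [norm_div, sia_norm_exp, norm_pow, pow_add, ← one_div_mul_one_div, ← one_div_pow]
          have := hinv x
          gcongr
        · rw [intervalIntegral.integral_of_le (by linarith), hK, ← integral_const_mul]
          exact setIntegral_le_integral hii (ae_of_all _ fun x => by positivity)
      simp only [hF, intervalIntegral.integral_const_mul]
      rw [norm_mul, hcoef]
      refine mul_le_mul_of_nonneg_left (hle.trans ?_) (by positivity)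
      have : M ^ (j + 1) * (K / M) = M ^ j * K := by rw [pow_succ]; field_simp
      rw [mul_add, this]
      have : 0 ≤ M ^ (j + 1) * (‖V‖ + 1) := by positivity
      linarith

/-- For `Im a > 0`, `c ≥ 0` and `t ≠ 0`, the symmetric improper
integral `lim_{R→∞} (1/2π) ∫_{−R}^{R} e^{ic/(ω−a)} e^{iωt}/(ω−a) dω` exists; it equals
`i e^{iat} Σ_{j≥0} (−ct)^j/(j!)²` for `t > 0` and `0` for `t < 0`. -/
theorem symmetric_improper_integral_first_order
    (a : ℂ) (ha : 0 < a.im) (c : ℝ) (hc : 0 ≤ c) (t : ℝ) (ht : t ≠ 0) :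
    (0 < t →
      Tendsto (fun R : ℝ => (1 / (2 * (Real.pi : ℂ))) *
          ∫ ω in (-R)..R,
            Complex.exp (Complex.I * (c : ℂ) / ((ω : ℂ) - a))
              * Complex.exp (Complex.I * (ω : ℂ) * (t : ℂ)) / ((ω : ℂ) - a))
        atTop
        (nhds (Complex.I * Complex.exp (Complex.I * a * (t : ℂ)) *
          ∑' j : ℕ, ((-(c * t) : ℝ) : ℂ) ^ j / ((Nat.factorial j : ℂ)) ^ 2))) ∧
    (t < 0 →
      Tendsto (fun R : ℝ => (1 / (2 * (Real.pi : ℂ))) *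
          ∫ ω in (-R)..R,
            Complex.exp (Complex.I * (c : ℂ) / ((ω : ℂ) - a))
              * Complex.exp (Complex.I * (ω : ℂ) * (t : ℂ)) / ((ω : ℂ) - a))
        atTop (nhds 0)) := by
  have hpi : (Real.pi : ℂ) ≠ 0 := Complex.ofReal_ne_zero.2 Real.pi_ne_zero
  constructor
  · intro h
    have := (sia_main a ha c t ht (2 * Real.pi * Complex.I * Complex.exp (Complex.I * a * t)) (by
      rw [max_eq_left h.le]
      linear_combination (2 * Real.pi * Complex.exp (Complex.I * a * t) * t : ℂ) * Complex.I_sq)).const_mul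
        (1 / (2 * (Real.pi : ℂ)))
    refine this.trans (le_of_eq ?_)
    congr 1
    field_simp
  · intro h
    have := (sia_main a ha c t ht 0 (by
      rw [max_eq_right h.le]; simp)).const_mul (1 / (2 * (Real.pi : ℂ)))
    simpa using this
end
end
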